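/- arXiv:0902.0135 — 2 statements merged into one kernel-verified Lean document; each statement's English description precedes it below -/
import Mathlib

section
/- Let a₀, b₀, a₁, b₁ be integers with 0 ≤ a₁ ≤ q and 0 ≤ b₁ ≤ q, and set a = a₀(q+1) − a₁, b = b₀(q+1) − b₁ and d* = a + b. Assume 0 ≤ a + b ≤ q³ − 1, and assume either a + b > q, or (a + b ≤ q and a₁ ≠ 0 and b₁ ≠ 0). If 0 ≤ b₁ ≤ a₀ + b₀ < a₁, then d(C((q−2)(q+1) + a, b)^⊥) = d* + a₁ − (a₀ + b₀). (Theorem 3.3, case 2.) -/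
open scoped BigOperators

namespace HermitianTwoPoint

/-- The affine points of the Hermitian curve `y^q + y = x^(q+1)` other than the origin. -/
def Dset (q : ℕ) (F : Type) [Field F] : Set (F × F) :=
  {P | P.2 ^ q + P.2 = P.1 ^ (q + 1) ∧ P ≠ 0}

/-- The exponent set describing a monomial basis of `L(m P∞ + n P₀)`. -/
def S (q : ℕ) (m n : ℤ) : Set (ℤ × ℤ) :=
  {ij | 0 ≤ ij.1 ∧ ij.1 ≤ (q : ℤ) ∧ (q : ℤ) * ij.1 + ((q : ℤ) + 1) * ij.2 ≤ m ∧
    -n ≤ ij.1 + ((q : ℤ) + 1) * ij.2}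

/-- Evaluation vector of the monomial `x^i y^j` at the points of `Dset`. -/
def evalVec (q : ℕ) (F : Type) [Field F] (ij : ℤ × ℤ) : ↥(Dset q F) → F :=
  fun P => (P : F × F).1 ^ ij.1 * (P : F × F).2 ^ ij.2

/-- The two-point Hermitian code `C(m,n)`. -/
noncomputable def Code (q : ℕ) (F : Type) [Field F] (m n : ℤ) :
    Submodule F (↥(Dset q F) → F) :=
  Submodule.span F (evalVec q F '' S q m n)

noncomputable instance (q : ℕ) (F : Type) [Field F] [Fintype F] : Fintype ↥(Dset q F) :=
  Fintype.ofFinite _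

/-- The dual code `C(m,n)^⊥`. -/
noncomputable def dualCode (q : ℕ) (F : Type) [Field F] [Fintype F] (m n : ℤ) :
    Set (↥(Dset q F) → F) :=
  {c | ∀ w ∈ Code q F m n, ∑ P, c P * w P = 0}

/-- Hamming weight of a word. -/
noncomputable def wt {q : ℕ} {F : Type} [Field F] (c : ↥(Dset q F) → F) : ℕ :=
  Nat.card {P // c P ≠ 0}

/-- Minimum distance of the dual code `C(m,n)^⊥`. -/
noncomputable def minDist (q : ℕ) (F : Type) [Field F] [Fintype F] (m n : ℤ) : ℕ :=
  sInf {w | ∃ c ∈ dualCode q F m n, c ≠ 0 ∧ wt c = w}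


lemma tri_card {F : Type*} [Field F] {ι κ : Type*} [Fintype ι] [Fintype κ]
    (c : ι → F) (f g : κ → ι → F) (o : κ → ℕ)
    (ho : Function.Injective o)
    (hz : ∀ k l, o k < o l → ∑ P, c P * (f k P * g l P) = 0)
    (hd : ∀ k, ∑ P, c P * (f k P * g k P) ≠ 0) :
    Fintype.card κ ≤ Nat.card {P // c P ≠ 0} := by
  classical
  let w : κ → ({P // c P ≠ 0} → F) := fun k P => c P * f k P
  have hli : LinearIndependent F w := by
    rw [Fintype.linearIndependent_iff]
    intro x hx
    by_contra hne
    push Not at hne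
    obtain ⟨k0, hk0⟩ := hne
    obtain ⟨l, hl, hmax⟩ := Finset.exists_max_image (Finset.univ.filter fun k => x k ≠ 0) o
      ⟨k0, by simp [hk0]⟩
    have hl' : x l ≠ 0 := by simpa using hl
    have key : ∑ k, x k * ∑ P, c P * (f k P * g l P) = 0 := by
      simp_rw [Finset.mul_sum]
      rw [Finset.sum_comm]
      apply Finset.sum_eq_zero
      intro P _
      by_cases hP : c P = 0
      · simp [hP]
      · have := congrFun hx ⟨P, hP⟩
        simp only [Finset.sum_apply, Pi.smul_apply, smul_eq_mul, Pi.zero_apply, w] at this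
        calc ∑ k, x k * (c P * (f k P * g l P)) = (∑ k, x k * (c P * f k P)) * g l P := by
              rw [Finset.sum_mul]; exact Finset.sum_congr rfl fun _ _ => by ring
          _ = 0 := by rw [this, zero_mul]
    rw [Finset.sum_eq_single l] at key
    · exact (mul_ne_zero hl' (hd l)) key
    · intro k _ hk
      by_cases hxk : x k = 0
      · simp [hxk]
      · have h1 := hmax k (by simp [hxk])
        have h2 : o k ≠ o l := fun h => hk (ho h)
        rw [hz k l (by omega), mul_zero]
    · simp
  have := hli.fintype_card_le_finrank
  simpa [Module.finrank_fintype_fun_eq_card, Nat.card_eq_fintype_card] using this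

lemma count_base (q s i j : ℕ) (hq : 2 ≤ q) (hs : 1 ≤ s) (hsq : s < q) (hi : i ≤ q)
    (h1 : i < q → q + s ≤ i + j + 2) (h2 : i = q → s ≤ j + 1) :
    s * q ≤ (i + 1) * (j + 1) + (q - i) * (j + 1 - q) := by
  rcases Nat.lt_or_ge i q with h | h
  · have h1 := h1 h
    obtain ⟨d, rfl⟩ := Nat.exists_eq_add_of_lt h
    by_cases hc : i + 1 ≤ s
    · obtain ⟨e, rfl⟩ := Nat.exists_eq_add_of_le hc
      have hj : j + 1 - (i + d + 1) ≥ e := by omega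
      have : (i + d + 1 - i) * (j + 1 - (i + d + 1)) ≥ (d+1) * e :=
        Nat.mul_le_mul (by omega) hj
      have : (i+1) * (j+1) ≥ (i+1) * (i + d + 1 + e) := Nat.mul_le_mul le_rfl (by omega)
      nlinarith
    · have : (i+1) * (j+1) ≥ (i+1) * (d + s) := Nat.mul_le_mul le_rfl (by omega)
      obtain ⟨e, he⟩ := Nat.exists_eq_add_of_lt (show s < i + 1 by omega)
      have h3 : i = s + e := by omega
      subst h3
      nlinarith [Nat.zero_le ((s+e+1) * d), Nat.zero_le (e*d)]
  · have : i = q := by omega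
    subst this
    have := h2 rfl
    nlinarith [Nat.mul_le_mul (le_refl (i+1)) this]

lemma count_pairs (q s i j b : ℕ) (hq : 2 ≤ q) (hs : 1 ≤ s) (hsq : s < q) (hi : i ≤ q)
    (h1 : i < q → q + s ≤ i + j + 2) (h2 : i = q → s ≤ j + 1) (t : ℕ → ℕ) (n : ℕ → ℕ)
    (ht : ∀ k, t k = if k ≤ i then i - k else i + q + 1 - k)
    (hn : ∀ k, n k = (if k ≤ i then j + 1 else j + 1 - q) - (if t k < b then 1 else 0)) :
    s * q ≤ b + ∑ k ∈ Finset.range (q+1), n k := by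
  have hb : ∑ k ∈ Finset.range (q+1), (if t k < b then 1 else 0) ≤ b := by
    rw [← Finset.card_filter]
    calc _ ≤ (Finset.range b).card := by
          apply Finset.card_le_card_of_injOn t
          · intro k hk
            simp at hk ⊢
            exact hk.2
          · intro k hk l hl h
            simp at hk hl
            rw [ht, ht] at h
            split_ifs at h <;> omega
      _ = b := by simp
  have hbase : ∑ k ∈ Finset.range (q+1), (if k ≤ i then j + 1 else j + 1 - q) =
      (i + 1) * (j + 1) + (q - i) * (j + 1 - q) := by
    obtain ⟨d, rfl⟩ := Nat.exists_eq_add_of_le hi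
    rw [show i + d + 1 = (i+1) + d by ring, Finset.sum_range_add]
    congr 1
    · rw [Finset.sum_congr rfl (g := fun _ => j + 1)]
      · simp
      · intro k hk; simp at hk; rw [if_pos (by omega)]
    · rw [Finset.sum_congr rfl (g := fun _ => j + 1 - (i + d))]
      · simp
      · intro k hk; rw [if_neg (by omega)]
  have := count_base q s i j hq hs hsq hi h1 h2
  rw [← hbase] at this
  have h3 : ∑ k ∈ Finset.range (q+1), (if k ≤ i then j + 1 else j + 1 - q) ≤
      ∑ k ∈ Finset.range (q+1), (n k + (if t k < b then 1 else 0)) := by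
    apply Finset.sum_le_sum
    intro k _
    rw [hn]; omega
  rw [Finset.sum_add_distrib] at h3
  omega

lemma ord_inj (q i j i' j' : ℕ) (hi : i ≤ q) (hi' : i' ≤ q)
    (h : q * i + (q+1) * j = q * i' + (q+1) * j') : i = i' ∧ j = j' := by
  have h2 : (i' : ℤ) - i = (q+1) * ((i':ℤ) + j' - i - j) := by
    have : ((q * i + (q+1) * j : ℕ) : ℤ) = (q * i' + (q+1) * j' : ℕ) := by rw [h]
    push_cast at this
    linarith
  have h3 : (i':ℤ) + j' - i - j = 0 := by
    by_contra hne
    rcases lt_or_gt_of_ne hne with hlt | hgt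
    · nlinarith
    · nlinarith
  rw [h3] at h2
  omega

lemma lower_bound {F : Type*} [Field F] {ι : Type*} [Fintype ι] (q b s a1 : ℕ) (u v c : ι → F)
    (hH : ∀ P, v P ^ q + v P = u P ^ (q+1)) (hq : 2 ≤ q) (hs : 1 ≤ s) (hsa : s < a1) (ha : a1 ≤ q)
    (hT : ∀ i j, i ≤ q → (i < b → 1 ≤ j) → i + j + (if i < a1 then 1 else 0) ≤ q - 2 + s →
      ∑ P, c P * (u P ^ i * v P ^ j) = 0)
    (hex : ∃ i j, i ≤ q ∧ 1 ≤ j ∧ ∑ P, c P * (u P ^ i * v P ^ j) ≠ 0) :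
    s * q ≤ b + Nat.card {P // c P ≠ 0} := by
  classical
  set φ : ℕ → ℕ → F := fun i j => ∑ P, c P * (u P ^ i * v P ^ j) with hφ
  have hred : ∀ i j, φ (i + (q+1)) j = φ i (j+q) + φ i (j+1) := by
    intro i j
    simp only [hφ]
    rw [← Finset.sum_add_distrib]
    refine Finset.sum_congr rfl fun P _ => ?_
    rw [pow_add, ← hH P]; ring
  have hexρ : ∃ ρ i j, i ≤ q ∧ (i < b → 1 ≤ j) ∧ φ i j ≠ 0 ∧ q * i + (q+1) * j = ρ := by
    obtain ⟨i, j, h1, h2, h3⟩ := hex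
    exact ⟨_, i, j, h1, fun _ => h2, h3, rfl⟩
  obtain ⟨i, j, hi, hj, hne, hρ⟩ := Nat.find_spec hexρ
  set ρ := Nat.find hexρ with hρdef
  have hmin : ∀ e f, e ≤ q → (e < b → 1 ≤ f) → q * e + (q+1) * f < ρ → φ e f = 0 := by
    intro e f h1 h2 h3
    by_contra h4
    exact Nat.find_min hexρ h3 ⟨e, f, h1, h2, h4, rfl⟩
  have hlt : ∀ e f, e ≤ 2 * q → (e < b → 1 ≤ f) → q * e + (q+1) * f < ρ → φ e f = 0 := by
    intro e f h1 h2 h3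
    by_cases he : e ≤ q
    · exact hmin e f he h2 h3
    · obtain ⟨d, rfl⟩ := Nat.exists_eq_add_of_le' (show q + 1 ≤ e by omega)
      rw [hred, hmin d (f+q) (by omega) (fun _ => by omega) (by nlinarith),
        hmin d (f+1) (by omega) (fun _ => by omega) (by nlinarith), add_zero]
  have heq : ∀ e f, e ≤ 2 * q → (e < b → 1 ≤ f) → q * e + (q+1) * f = ρ → φ e f ≠ 0 := by
    intro e f h1 h2 h3
    by_cases he : e ≤ q
    · obtain ⟨rfl, rfl⟩ := ord_inj q e f i j he hi (by omega)
      exact hne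
    · obtain ⟨d, rfl⟩ := Nat.exists_eq_add_of_le' (show q + 1 ≤ e by omega)
      rw [hred, hmin d (f+1) (by omega) (fun _ => by omega) (by nlinarith), add_zero]
      obtain ⟨rfl, rfl⟩ := ord_inj q d (f+q) i j (by omega) hi (by rw [hρ, ← h3]; ring)
      exact hne
  have hnT : ¬ (i + j + (if i < a1 then 1 else 0) ≤ q - 2 + s) := fun h => hne (hT i j hi hj h)
  let t : ℕ → ℕ := fun k => if k ≤ i then i - k else i + q + 1 - k
  let n : ℕ → ℕ := fun k => (if k ≤ i then j + 1 else j + 1 - q) - (if t k < b then 1 else 0)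
  have hcount := count_pairs q s i j b hq hs (by omega) hi
    (by intro h; split_ifs at hnT <;> omega)
    (by intro h; rw [if_neg (by omega)] at hnT; omega) t n (fun _ => rfl) (fun _ => rfl)
  let κ := (k : Fin (q+1)) × Fin (n k)
  let J : ℕ → ℕ := fun k => if k ≤ i then j else j - q
  let o : κ → ℕ := fun x => q * x.1 + (q+1) * x.2
  have ht2 : ∀ x : κ, t x.1 ≤ q ∧ (t x.1 < b → 1 ≤ J x.1 - x.2) ∧
      o x + (q * t x.1 + (q+1) * (J x.1 - x.2)) = ρ := by
    rintro ⟨⟨k, hk⟩, ⟨l, hl⟩⟩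
    simp only [t, n, J, o] at hl ⊢
    by_cases hki : k ≤ i
    · simp only [if_pos hki] at hl ⊢
      obtain ⟨e, rfl⟩ := Nat.exists_eq_add_of_le hki
      obtain ⟨f, rfl⟩ := Nat.exists_eq_add_of_le (show l ≤ j by omega)
      refine ⟨by omega, fun h => ?_, ?_⟩
      · rw [if_pos h] at hl; omega
      · rw [← hρ]; simp only [Nat.add_sub_cancel_left]; ring
    · simp only [if_neg hki] at hl ⊢
      obtain ⟨f, rfl⟩ := Nat.exists_eq_add_of_le (show l + q ≤ j by omega)
      obtain ⟨e, he⟩ := Nat.exists_eq_add_of_le (show k ≤ i + q + 1 by omega)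
      rw [he, Nat.add_sub_cancel_left] at hl ⊢
      rw [show l + q + f - q - l = f by omega]
      refine ⟨by omega, fun h => ?_, ?_⟩
      · rw [if_pos h] at hl; omega
      · rw [← hρ]; zify at he ⊢; linear_combination (-(q:ℤ)) * he
  have := tri_card (κ := κ) c (fun x P => u P ^ (x.1 : ℕ) * v P ^ (x.2 : ℕ))
    (fun x P => u P ^ (t x.1) * v P ^ (J x.1 - x.2)) o ?_ ?_ ?_
  · rw [Fintype.card_sigma] at this
    simp only [Fintype.card_fin] at this
    rw [Fin.sum_univ_eq_sum_range (fun k => n k)] at this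
    omega
  · rintro ⟨⟨k, hk⟩, ⟨l, hl⟩⟩ ⟨⟨k', hk'⟩, ⟨l', hl'⟩⟩ h
    obtain ⟨rfl, rfl⟩ := ord_inj q k l k' l' (by omega) (by omega) h
    rfl
  · intro x y hxy
    obtain ⟨h1, h2, h3⟩ := ht2 y
    have := hlt (x.1 + t y.1) (x.2 + (J y.1 - y.2)) (by have := x.1.2; omega) (fun h => by
      have := h2 (by omega); omega) (by simp only [o] at *; nlinarith)
    rw [← this]
    exact Finset.sum_congr rfl fun P _ => by ring
  · intro x
    obtain ⟨h1, h2, h3⟩ := ht2 x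
    have := heq (x.1 + t x.1) (x.2 + (J x.1 - x.2)) (by have := x.1.2; omega) (fun h => by
      have := h2 (by omega); omega) (by simp only [o] at *; nlinarith)
    intro h0
    apply this
    rw [← h0]
    exact Finset.sum_congr rfl fun P _ => by ring


lemma exists_nonzero {F : Type*} [Field F] [Fintype F] {ι : Type*} [Fintype ι] (q : ℕ)
    (u v c : ι → F) (hH : ∀ P, v P ^ q + v P = u P ^ (q+1)) (hq : 2 ≤ q)
    (hinj : ∀ P Q, u P = u Q → v P = v Q → P = Q) (hv : ∀ P, v P ≠ 0) (hc : c ≠ 0) :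
    ∃ i j, i ≤ q ∧ 1 ≤ j ∧ ∑ P, c P * (u P ^ i * v P ^ j) ≠ 0 := by
  classical
  by_contra hcon
  push Not at hcon
  have hall : ∀ i j, 1 ≤ j → ∑ P, c P * (u P ^ i * v P ^ j) = 0 := by
    intro i
    induction i using Nat.strong_induction_on with
    | _ i ih =>
      intro j hj
      by_cases hi : i ≤ q
      · exact hcon i j hi hj
      · obtain ⟨d, rfl⟩ := Nat.exists_eq_add_of_le' (show q + 1 ≤ i by omega)
        have h1 := ih d (by omega) (j+q) (by omega)
        have h2 := ih d (by omega) (j+1) (by omega)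
        rw [← add_zero (0:F)]
        nth_rewrite 1 [← h1]
        rw [← h2, ← Finset.sum_add_distrib]
        refine Finset.sum_congr rfl fun P _ => ?_
        rw [pow_add (u P), ← hH P]; ring
  have hpoly : ∀ p r : Polynomial F, ∑ P, c P * (p.eval (u P) * (v P * r.eval (v P))) = 0 := by
    intro p r
    have hexp : ∀ P, c P * (p.eval (u P) * (v P * r.eval (v P))) =
        ∑ i ∈ Finset.range (p.natDegree + 1), ∑ j ∈ Finset.range (r.natDegree + 1),
          p.coeff i * r.coeff j * (c P * (u P ^ i * v P ^ (j+1))) := by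
      intro P
      rw [Polynomial.eval_eq_sum_range, Polynomial.eval_eq_sum_range, Finset.mul_sum,
        Finset.sum_mul_sum, Finset.mul_sum]
      refine Finset.sum_congr rfl fun i _ => ?_
      rw [Finset.mul_sum]
      exact Finset.sum_congr rfl fun j _ => by ring
    simp_rw [hexp]
    rw [Finset.sum_comm]
    refine Finset.sum_eq_zero fun i _ => ?_
    rw [Finset.sum_comm]
    refine Finset.sum_eq_zero fun j _ => ?_
    have := hall i (j+1) (by omega)
    calc _ = p.coeff i * r.coeff j * ∑ P, c P * (u P ^ i * v P ^ (j+1)) := by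
            rw [Finset.mul_sum]
      _ = 0 := by rw [this, mul_zero]
  apply hc
  funext P₀
  let L : F → Polynomial F := fun x => ∏ y ∈ Finset.univ.erase x, (Polynomial.X - Polynomial.C y)
  have hL0 : ∀ x y, y ≠ x → (L x).eval y = 0 := by
    intro x y h
    simp only [L, Polynomial.eval_prod]
    exact Finset.prod_eq_zero (i := y) (by simp [h]) (by simp)
  have hL1 : ∀ x, (L x).eval x ≠ 0 := by
    intro x
    simp only [L, Polynomial.eval_prod]
    refine Finset.prod_ne_zero_iff.2 fun y hy => ?_
    simp at hy
    simp [sub_ne_zero, Ne.symm hy]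
  have := hpoly (L (u P₀)) (L (v P₀))
  rw [Finset.sum_eq_single P₀] at this
  · simpa [hL1, hv] using this
  · intro P _ hP
    by_cases h1 : u P = u P₀
    · by_cases h2 : v P = v P₀
      · exact absurd (hinj _ _ h1 h2) hP
      · rw [hL0 _ _ h2]; ring
    · rw [hL0 _ _ h1]; ring
  · simp

lemma fiber_count {α β : Type*} [DecidableEq β] (A : Finset α) (B : Finset β) (f : α → β) (n m : ℕ)
    (hf : ∀ x ∈ A, f x ∈ B) (hA : n * m ≤ A.card) (hB : B.card ≤ m)
    (hn : 0 < n)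
    (hfib : ∀ y ∈ B, (A.filter fun x => f x = y).card ≤ n) :
    B.card = m ∧ ∀ y ∈ B, (A.filter fun x => f x = y).card = n := by
  have h := Finset.card_eq_sum_card_fiberwise (f := f) (s := A) (t := B) (fun x hx => hf x hx)
  have h2 : ∑ y ∈ B, (A.filter fun x => f x = y).card ≤ ∑ y ∈ B, n := Finset.sum_le_sum hfib
  have h3 : ∑ y ∈ B, n = B.card * n := by simp
  have h4 : B.card * n ≤ m * n := Nat.mul_le_mul hB le_rfl
  have h5 : B.card * n = m * n := by nlinarith
  refine ⟨Nat.eq_of_mul_eq_mul_right hn h5, ?_⟩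
  have h6 : ∑ y ∈ B, (A.filter fun x => f x = y).card = ∑ y ∈ B, n := by nlinarith
  exact (Finset.sum_eq_sum_iff_of_le hfib).1 h6

lemma card_roots_le {F : Type*} [Field F] [DecidableEq F] (A : Finset F) (p : Polynomial F) (n : ℕ)
    (hd : p.natDegree ≤ n) (hp : p ≠ 0) (h : ∀ x ∈ A, p.eval x = 0) : A.card ≤ n := by
  calc A.card ≤ p.roots.toFinset.card := Finset.card_le_card fun x hx => by
        simp [hp, h x hx]
    _ ≤ p.roots.card := Multiset.toFinset_card_le _
    _ ≤ p.natDegree := Polynomial.card_roots' p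
    _ ≤ n := hd

lemma frob_add (q : ℕ) (hpp : IsPrimePow q)
    (F : Type*) [Field F] [Fintype F] (hF : Fintype.card F = q ^ 2) (x y : F) :
    (x + y) ^ q = x ^ q + y ^ q := by
  obtain ⟨p, k, hp, hk, rfl⟩ := hpp
  have hp' : p.Prime := hp.nat_prime
  have := Fact.mk hp'
  have : CharP F p := by
    apply charP_of_card_eq_prime_pow (f := k*2) 
    rw [← pow_mul] at hF
    simpa using hF
  exact add_pow_char_pow ..

open Polynomial in
lemma norm_count (q : ℕ) (hq : 2 ≤ q) (F : Type*) [Field F] [Fintype F] [DecidableEq F]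
    (hF : Fintype.card F = q ^ 2) :
    (Finset.univ.filter fun w : F => w ^ (q+1) = 1).card = q + 1 ∧
    ∀ w : F, w ^ (q+1) = 1 → (Finset.univ.filter fun x : F => x ≠ 0 ∧ x ^ (q-1) = w).card = q - 1 := by
  have hsq : (q-1) * (q+1) = q^2 - 1 := by
    obtain ⟨d, rfl⟩ := Nat.exists_eq_add_of_le' (show 1 ≤ q by omega)
    have : (d+1)^2 = d * (d+1+1) + 1 := by ring
    rw [this]; simp
  have := fiber_count (Finset.univ.filter fun x : F => x ≠ 0)
    (Finset.univ.filter fun w : F => w ^ (q+1) = 1) (fun x => x ^ (q-1)) (q-1) (q+1)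
    (by
      intro x hx
      simp at hx ⊢
      rw [← pow_mul, hsq, ← hF]
      exact FiniteField.pow_card_sub_one_eq_one x hx)
    (by
      rw [hsq, ← hF, Finset.filter_ne' , Finset.card_erase_of_mem (by simp), Finset.card_univ])
    (by
      apply card_roots_le _ (X ^ (q+1) - C 1) (q+1) (natDegree_X_pow_sub_C.le)
      · exact X_pow_sub_C_ne_zero (by omega) _
      · intro x hx; simp at hx; simp [hx])
    (by omega)
    (by
      intro y hy
      apply card_roots_le _ (X ^ (q-1) - C y) (q-1) (natDegree_X_pow_sub_C.le)
      · exact X_pow_sub_C_ne_zero (by omega) _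
      · intro x hx; simp at hx; simp [hx])
  refine ⟨this.1, fun w hw => ?_⟩
  have h := this.2 w (by simp [hw])
  rwa [Finset.filter_filter] at h

open Polynomial in
lemma trace_count (q : ℕ) (hq : 2 ≤ q) (hpp : IsPrimePow q) (F : Type*) [Field F] [Fintype F] [DecidableEq F]
    (hF : Fintype.card F = q ^ 2) (a : F) :
    (Finset.univ.filter fun v : F => v ^ q + v = a ^ (q+1)).card = q := by
  have hfix : ∀ x : F, (x ^ q) ^ q = x := by
    intro x
    rw [← pow_mul, ← sq, ← hF, FiniteField.pow_card]
  have := fiber_count (Finset.univ : Finset F)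
    (Finset.univ.filter fun w : F => w ^ q = w) (fun x => x ^ q + x) q q
    (by
      intro x hx
      simp
      rw [frob_add q hpp F hF, hfix, add_comm])
    (by
      rw [Finset.card_univ, hF, sq])
    (by
      apply card_roots_le _ (X ^ q - X) q
      · rw [FiniteField.X_pow_card_sub_X_natDegree_eq F (by omega)]
      · exact FiniteField.X_pow_card_sub_X_ne_zero F (by omega)
      · intro x hx; simp at hx; simp [hx])
    (by omega)
    (by
      intro y hy
      have hdeg : (X ^ q + (X - C y) : F[X]).natDegree = q := by
        rw [natDegree_add_eq_left_of_natDegree_lt, natDegree_X_pow]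
        rw [natDegree_X_pow, natDegree_X_sub_C]; omega
      apply card_roots_le _ (X ^ q + (X - C y)) q hdeg.le
      · intro h
        rw [h] at hdeg
        simp at hdeg
        omega
      · intro x hx; simp at hx; simp [← hx])
  apply this.2
  simp
  rw [← pow_mul, add_mul, one_mul, ← sq, pow_add, ← hF, FiniteField.pow_card, pow_succ, mul_comm]

lemma ord_le_iff (q a K i j : ℕ) (hi : i ≤ q) (ha : a ≤ q) :
    q * i + (q+1) * j + a ≤ (q+1) * K ↔ i + j + (if i < a then 1 else 0) ≤ K := by
  constructor
  · intro h
    by_contra hc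
    split_ifs at hc with hia
    · have : K ≤ i + j := by omega
      have := Nat.mul_le_mul (le_refl (q+1)) this
      nlinarith
    · have : K + 1 ≤ i + j := by omega
      have := Nat.mul_le_mul (le_refl (q+1)) this
      nlinarith
  · intro h
    split_ifs at h with hia
    · have := Nat.mul_le_mul (le_refl (q+1)) h
      nlinarith
    · have := Nat.mul_le_mul (le_refl (q+1)) h
      nlinarith

def Tset (q s a1 b : ℕ) : Finset (ℕ × ℕ) :=
  (Finset.range (q+1) ×ˢ Finset.range (q+s+1)).filter fun x =>
    (x.1 < b → 1 ≤ x.2) ∧ x.1 + x.2 + (if x.1 < a1 then 1 else 0) ≤ q - 2 + s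

lemma mem_Tset {q s a1 b : ℕ} {x : ℕ × ℕ} : x ∈ Tset q s a1 b ↔
    x.1 ≤ q ∧ (x.1 < b → 1 ≤ x.2) ∧ x.1 + x.2 + (if x.1 < a1 then 1 else 0) ≤ q - 2 + s := by
  simp only [Tset, Finset.mem_filter, Finset.mem_product, Finset.mem_range]
  omega

lemma sum_delta (n a : ℕ) (h : a ≤ n) : ∑ i ∈ Finset.range n, (if i < a then 1 else 0) = a := by
  rw [← Finset.card_filter]
  have : (Finset.range n).filter (fun i => i < a) = Finset.range a := by
    ext x; simp; omega
  rw [this]; simp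

lemma card_Tset (q s a1 b : ℕ) (hq : 2 ≤ q) (hs : 1 ≤ s) (hsa : s < a1) (ha : a1 ≤ q) (hbs : b ≤ s) :
    2 * ((Tset q s a1 b).card + a1 + b) + q * (q + 1) = 2 * ((q+1) * (q-1+s)) := by
  have h1 : (Tset q s a1 b).card =
      ∑ i ∈ Finset.range (q+1), (q-1+s-i-(if i < a1 then 1 else 0)-(if i < b then 1 else 0)) := by
    rw [Finset.card_eq_sum_card_fiberwise (f := Prod.fst) (t := Finset.range (q+1))]
    · refine Finset.sum_congr rfl fun i hi => ?_
      simp only [Finset.mem_range] at hi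
      have : (Tset q s a1 b).filter (fun x => x.1 = i) =
          ((Finset.Ico (if i < b then 1 else 0) (q-1+s-i-(if i < a1 then 1 else 0))).image
            fun j => (i, j)) := by
        ext ⟨x, y⟩
        simp only [Finset.mem_filter, mem_Tset, Finset.mem_image, Finset.mem_Ico, Prod.mk.injEq]
        constructor
        · rintro ⟨⟨h1, h2, h3⟩, rfl⟩
          refine ⟨y, ⟨?_, ?_⟩, rfl, rfl⟩
          · split_ifs with h
            · exact h2 h
            · omega
          · split_ifs at h3 ⊢ <;> omega
        · rintro ⟨j, ⟨h1, h2⟩, rfl, rfl⟩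
          refine ⟨⟨by omega, fun h => by simpa [h] using h1, ?_⟩, rfl⟩
          split_ifs at h2 ⊢ <;> omega
      rw [this, Finset.card_image_of_injective _ (fun x y h => by simpa using h), Nat.card_Ico]
    · intro x hx
      have := (mem_Tset.1 hx).1
      simp; omega
  have h2 : ∑ i ∈ Finset.range (q+1), ((q-1+s-i-(if i < a1 then 1 else 0)-(if i < b then 1 else 0))
      + i + (if i < a1 then 1 else 0) + (if i < b then 1 else 0)) =
      ∑ i ∈ Finset.range (q+1), (q-1+s) := by
    refine Finset.sum_congr rfl fun i hi => ?_
    simp only [Finset.mem_range] at hi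
    split_ifs <;> omega
  rw [Finset.sum_add_distrib, Finset.sum_add_distrib, Finset.sum_add_distrib, ← h1,
    sum_delta _ _ (by omega), sum_delta _ _ (by omega)] at h2
  have h3 := Finset.sum_range_id_mul_two (q+1)
  simp at h2 h3
  rw [← h2]
  linarith

lemma card_Tset' (q r : ℕ) (hq : 2 ≤ q) (hr : r + 1 ≤ q) :
    2 * ((Tset q 0 r 0).card + r) = q * (q - 1) := by
  have h1 : (Tset q 0 r 0).card =
      ∑ i ∈ Finset.range (q-1), (q-1-i-(if i < r then 1 else 0)) := by
    rw [Finset.card_eq_sum_card_fiberwise (f := Prod.fst) (t := Finset.range (q-1))]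
    · refine Finset.sum_congr rfl fun i hi => ?_
      simp only [Finset.mem_range] at hi
      have : (Tset q 0 r 0).filter (fun x => x.1 = i) =
          ((Finset.range (q-1-i-(if i < r then 1 else 0))).image
            fun j => (i, j)) := by
        ext ⟨x, y⟩
        simp only [Finset.mem_filter, mem_Tset, Finset.mem_image, Finset.mem_range, Prod.mk.injEq]
        constructor
        · rintro ⟨⟨h1, h2, h3⟩, rfl⟩
          refine ⟨y, ?_, rfl, rfl⟩
          split_ifs at h3 ⊢ <;> omega
        · rintro ⟨j, h2, rfl, rfl⟩
          refine ⟨⟨by omega, fun h => by omega, ?_⟩, rfl⟩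
          split_ifs at h2 ⊢ <;> omega
      rw [this, Finset.card_image_of_injective _ (fun x y h => by simpa using h), Finset.card_range]
    · intro x hx
      have := (mem_Tset.1 hx).2.2
      simp; omega
  have h2 : ∑ i ∈ Finset.range (q-1), ((q-1-i-(if i < r then 1 else 0))
      + i + (if i < r then 1 else 0)) =
      ∑ i ∈ Finset.range (q-1), (q-1) := by
    refine Finset.sum_congr rfl fun i hi => ?_
    simp only [Finset.mem_range] at hi
    split_ifs <;> omega
  rw [Finset.sum_add_distrib, Finset.sum_add_distrib, ← h1,
    sum_delta _ _ (by omega)] at h2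
  have h3 := Finset.sum_range_id_mul_two (q-1)
  simp at h2
  obtain ⟨d, rfl⟩ := Nat.exists_eq_add_of_le' (show 1 ≤ q by omega)
  simp at h2 h3 ⊢
  obtain ⟨d, rfl⟩ := Nat.exists_eq_add_of_le' (show 1 ≤ d by omega)
  simp at h2 h3 ⊢
  nlinarith

lemma upper_exists {F : Type*} [Field F] {ι : Type*} [Fintype ι] (q b s a1 : ℕ) (u v : ι → F)
    (hH : ∀ P, v P ^ q + v P = u P ^ (q+1)) (hq : 2 ≤ q) (hs : 1 ≤ s) (hsa : s < a1) (ha : a1 ≤ q)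
    (hbs : b ≤ s)
    (hrel : (fun P => u P ^ s) ∈ Submodule.span F {g : ι → F | ∃ e f, e ≤ s ∧ (e < b → 1 ≤ f) ∧
      q * e + (q+1) * f < s * q ∧ g = fun P => u P ^ e * v P ^ f})
    (hcard : s * q ≤ b + Fintype.card ι) :
    ∃ c : ι → F, c ≠ 0 ∧
    ∀ i j, i ≤ q → (i < b → 1 ≤ j) → i + j + (if i < a1 then 1 else 0) ≤ q - 2 + s →
      ∑ P, c P * (u P ^ i * v P ^ j) = 0 := by
  classical
  let E : ℕ × ℕ → ι → F := fun x P => u P ^ x.1 * v P ^ x.2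
  have hEred : ∀ i j, E (i + (q+1), j) = E (i, j+q) + E (i, j+1) := by
    intro i j
    funext P
    simp only [E, Pi.add_apply]
    rw [pow_add, ← hH P]; ring
  let τ : ℕ × ℕ → ℕ × ℕ := fun x => if x.1 + s ≤ q then (x.1 + s, x.2) else (x.1 + s - q - 1, x.2 + q)
  let o : ℕ × ℕ → ℕ := fun x => q * x.1 + (q+1) * x.2
  have hoτ : ∀ x, o (τ x) = o x + s * q := by
    rintro ⟨i, j⟩
    simp only [τ, o]
    split_ifs with h
    · ring
    · obtain ⟨d, hd⟩ := Nat.exists_eq_add_of_le' (show q + 1 ≤ i + s by omega)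
      rw [show i + s - q - 1 = d by omega]
      zify at hd ⊢
      linear_combination (-(q:ℤ)) * hd
  set T := Tset q s a1 b with hTdef
  set T' := Tset q 0 (a1 - s) 0 with hT'def
  have hT' : ∀ x ∈ T', x.1 + x.2 ≤ q - 2 := by
    intro x hx
    have := (mem_Tset.1 hx).2.2
    omega
  have hτT : ∀ x ∈ T', τ x ∈ T := by
    intro x hx
    have h1 := mem_Tset.1 hx
    have h2 := hT' x hx
    have h5 : (τ x).1 ≤ q := by
      simp only [τ]; split_ifs <;> simp <;> omega
    have h3 := (ord_le_iff q (a1 - s) (q - 2 + 0) x.1 x.2 h1.1 (by omega)).2 h1.2.2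
    have h4 := (ord_le_iff q a1 (q - 2 + s) (τ x).1 (τ x).2 h5 ha).1 (by
      have := hoτ x
      simp only [o] at this
      rw [this]
      obtain ⟨r, rfl⟩ := Nat.exists_eq_add_of_lt hsa
      rw [show s + r + 1 - s = r + 1 by omega] at h3
      nlinarith)
    refine mem_Tset.2 ⟨h5, ?_, h4⟩
    simp only [τ]
    split_ifs <;> simp <;> omega
  have hτinj : Set.InjOn τ T' := by
    intro x hx y hy h
    have h1 := hoτ x
    rw [h, hoτ y] at h1
    have := ord_inj q x.1 x.2 y.1 y.2 (mem_Tset.1 hx).1 (mem_Tset.1 hy).1 (by simp only [o] at h1; omega)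
    exact Prod.ext this.1 this.2
  have hcardτ : (T'.image τ).card = T'.card := Finset.card_image_of_injOn hτinj
  have hsub : T'.image τ ⊆ T := by
    intro x hx
    obtain ⟨y, hy, rfl⟩ := Finset.mem_image.1 hx
    exact hτT y hy
  have hcardU : (T \ T'.image τ).card + b + 1 = s * q := by
    rw [Finset.card_sdiff_of_subset hsub, hcardτ]
    have h1 := card_Tset q s a1 b hq hs hsa ha hbs
    have h2 := card_Tset' q (a1 - s) hq (by omega)
    rw [← hTdef] at h1
    rw [← hT'def] at h2
    have h3 := Finset.card_le_card hsub
    rw [hcardτ] at h3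
    obtain ⟨d, hd⟩ := Nat.exists_eq_add_of_le h3
    rw [hd] at h1 ⊢
    obtain ⟨r, rfl⟩ := Nat.exists_eq_add_of_lt hsa
    rw [show s + r + 1 - s = r + 1 by omega] at h2
    obtain ⟨k, rfl⟩ := Nat.exists_eq_add_of_le' (show 1 ≤ q by omega)
    simp at h1 h2 ⊢
    nlinarith
  let V : Submodule F (ι → F) := Submodule.span F ((T \ T'.image τ).image E : Finset (ι → F))
  have hV : ∀ p, ∀ x ∈ T, o x = p → E x ∈ V := by
    intro p
    induction p using Nat.strong_induction_on with
    | _ p ih =>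
      intro x hx hxp
      by_cases hxτ : x ∈ T'.image τ
      · have hom : o x + a1 ≤ (q+1) * (q-2+s) :=
          (ord_le_iff q a1 (q-2+s) x.1 x.2 (mem_Tset.1 hx).1 ha).2 (mem_Tset.1 hx).2.2
        have hlow1 : ∀ e f, e ≤ q → (e < b → 1 ≤ f) → q * e + (q+1) * f < p → E (e, f) ∈ V := by
          intro e f h1 h2 h3
          refine ih _ h3 (e, f) (mem_Tset.2 ⟨h1, h2, ?_⟩) rfl
          exact (ord_le_iff q a1 (q-2+s) e f h1 ha).1 (by omega)
        have hlow : ∀ e f, e ≤ 2 * q → (e < b → 1 ≤ f) → q * e + (q+1) * f < p → E (e, f) ∈ V := by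
          intro e f h1 h2 h3
          by_cases he : e ≤ q
          · exact hlow1 e f he h2 h3
          · obtain ⟨d, rfl⟩ := Nat.exists_eq_add_of_le' (show q + 1 ≤ e by omega)
            rw [hEred]
            exact V.add_mem (hlow1 d (f+q) (by omega) (fun _ => by omega) (by nlinarith))
              (hlow1 d (f+1) (by omega) (fun _ => by omega) (by nlinarith))
        obtain ⟨⟨i, j⟩, hy, rfl⟩ := Finset.mem_image.1 hxτ
        have hij := hT' _ hy
        simp only at hij
        have hop := hoτ (i, j)
        rw [hxp] at hop
        simp only [o] at hop
        have hbig : E (i + s, j) ∈ V := by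
          have hmem := Submodule.mem_map_of_mem (f := LinearMap.mulLeft F (E (i, j))) hrel
          have heq : LinearMap.mulLeft F (E (i, j)) (fun P => u P ^ s) = E (i + s, j) := by
            funext P
            simp only [LinearMap.mulLeft_apply, Pi.mul_apply, E]
            ring
          rw [heq, Submodule.map_span] at hmem
          refine (Submodule.span_le.2 ?_) hmem
          rintro _ ⟨g, ⟨e, f, he, hf, hef, rfl⟩, rfl⟩
          have := hlow (i + e) (j + f) (by omega) (fun h => by have := hf (by omega); omega)
            (by nlinarith)
          rw [SetLike.mem_coe]
          convert this using 1
          funext P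
          simp only [LinearMap.mulLeft_apply, Pi.mul_apply, E]
          ring
        by_cases his : i + s ≤ q
        · simpa only [τ, if_pos his] using hbig
        · obtain ⟨d, hd⟩ := Nat.exists_eq_add_of_le' (show q + 1 ≤ i + s by omega)
          simp only [τ, if_neg his]
          rw [show i + s - q - 1 = d by omega]
          rw [hd, hEred] at hbig
          have h2 := hlow d (j+1) (by omega) (fun _ => by omega) (by
            have : q * d + q * (q + 1) = q * i + q * s := by rw [← mul_add, ← mul_add, hd]
            nlinarith)
          exact (V.add_mem_iff_left h2).1 hbig
      · apply Submodule.subset_span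
        simp only [Finset.coe_image, Set.mem_image]
        exact ⟨x, by simp [hx] at hxτ ⊢; exact hxτ, rfl⟩
  have hVlt : V < ⊤ := by
    rw [lt_top_iff_ne_top]
    intro h
    have h1 : Module.finrank F V ≤ (T \ T'.image τ).card :=
      (finrank_span_finset_le_card _).trans Finset.card_image_le
    rw [h, finrank_top, Module.finrank_fintype_fun_eq_card] at h1
    omega
  obtain ⟨φ, hφ, hVφ⟩ := Submodule.exists_le_ker_of_lt_top V hVlt
  have hrep : ∀ w, φ w = ∑ P, φ (Pi.single P 1) * w P := by
    intro w
    conv_lhs => rw [← Finset.univ_sum_single w, map_sum]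
    refine Finset.sum_congr rfl fun P _ => ?_
    have : (Pi.single P (w P) : ι → F) = w P • Pi.single P 1 := by
      rw [← Pi.single_smul]; simp
    rw [this, map_smul, smul_eq_mul, mul_comm]
  refine ⟨fun P => φ (Pi.single P 1), ?_, ?_⟩
  · intro h0
    apply hφ
    ext w
    have : ∀ P, φ (Pi.single P 1) = 0 := fun P => congrFun h0 P
    simp [this]
  · intro i j h1 h2 h3
    have := hVφ (hV _ (i, j) (mem_Tset.2 ⟨h1, h2, h3⟩) rfl)
    rw [LinearMap.mem_ker, hrep] at this
    exact this

lemma span_mul_mem {F R : Type*} [Field F] [CommRing R] [Algebra F R] {A B : Set R}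
    {W : Submodule F R} {f g : R} (hf : f ∈ Submodule.span F A) (hg : g ∈ Submodule.span F B)
    (h : ∀ x ∈ A, ∀ y ∈ B, x * y ∈ W) : f * g ∈ W := by
  have h1 := Submodule.mul_mem_mul hf hg
  rw [Submodule.span_mul_span] at h1
  refine Submodule.span_le.2 ?_ h1
  rintro _ ⟨x, hx, y, hy, rfl⟩
  exact h x hx y hy

def lowSet (q : ℕ) (F : Type*) [Field F] (s b : ℕ) : Set (F × F → F) :=
  {g | ∃ e f, e ≤ s ∧ b ≤ e + (q+1) * f ∧ q * e + (q+1) * f < s * q ∧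
    g = fun P => P.1 ^ e * P.2 ^ f}

def GoodFn (q : ℕ) {F : Type*} [Field F] (s b : ℕ) (h : F × F → F) : Prop :=
  b ≤ s ∧ (h - fun P => P.1 ^ s) ∈ Submodule.span F (lowSet q F s b)

lemma GoodFn.one (q : ℕ) {F : Type*} [Field F] : GoodFn q 0 0 (1 : F × F → F) := by
  refine ⟨le_rfl, ?_⟩
  convert Submodule.zero_mem _
  funext P; simp

lemma GoodFn.x (q : ℕ) {F : Type*} [Field F] : GoodFn q 1 1 (fun P : F × F => P.1) := by
  refine ⟨le_rfl, ?_⟩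
  convert Submodule.zero_mem _
  funext P; simp

lemma GoodFn.line (q : ℕ) (hq : 2 ≤ q) {F : Type*} [Field F] (α : F) :
    GoodFn q 1 0 (fun P : F × F => P.1 - α) := by
  refine ⟨by omega, ?_⟩
  have : (fun P : F × F => P.1 ^ 0 * P.2 ^ 0) ∈ Submodule.span F (lowSet q F 1 0) :=
    Submodule.subset_span ⟨0, 0, by omega, by omega, by omega, rfl⟩
  convert Submodule.smul_mem _ (-α) this using 1
  funext P; simp

lemma GoodFn.conic (q : ℕ) (hq : 2 ≤ q) {F : Type*} [Field F] (c : F) :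
    GoodFn q 2 2 (fun P : F × F => P.1 ^ 2 - c * P.2) := by
  refine ⟨by omega, ?_⟩
  have : (fun P : F × F => P.1 ^ 0 * P.2 ^ 1) ∈ Submodule.span F (lowSet q F 2 2) :=
    Submodule.subset_span ⟨0, 1, by omega, by omega, by omega, rfl⟩
  convert Submodule.smul_mem _ (-c) this using 1
  funext P; simp

lemma GoodFn.mul {q : ℕ} {F : Type*} [Field F] {s b s' b' : ℕ} {h h' : F × F → F}
    (H : GoodFn q s b h) (H' : GoodFn q s' b' h') : GoodFn q (s + s') (b + b') (h * h') := by
  obtain ⟨h1, h2⟩ := H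
  obtain ⟨h1', h2'⟩ := H'
  refine ⟨by omega, ?_⟩
  have hx : ∀ n, (fun P : F × F => P.1 ^ n) ∈ Submodule.span F {fun P : F × F => P.1 ^ n} :=
    fun n => Submodule.subset_span rfl
  have e : (h * h' - fun P : F × F => P.1 ^ (s + s')) =
      (h - fun P => P.1 ^ s) * (h' - fun P => P.1 ^ s') + (fun P => P.1 ^ s) * (h' - fun P => P.1 ^ s')
      + (h - fun P => P.1 ^ s) * (fun P => P.1 ^ s') := by
    funext P
    simp only [Pi.add_apply, Pi.mul_apply, Pi.sub_apply]
    ring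
  rw [e]
  refine Submodule.add_mem _ (Submodule.add_mem _ ?_ ?_) ?_
  · refine span_mul_mem h2 h2' ?_
    rintro _ ⟨i, j, a1, a2, a3, rfl⟩ _ ⟨i', j', a1', a2', a3', rfl⟩
    refine Submodule.subset_span ⟨i + i', j + j', by omega, by nlinarith, by nlinarith, ?_⟩
    funext P; simp only [Pi.mul_apply]; ring
  · refine span_mul_mem (hx s) h2' ?_
    rintro _ rfl _ ⟨i', j', a1', a2', a3', rfl⟩
    refine Submodule.subset_span ⟨s + i', j', by omega, by nlinarith, by nlinarith, ?_⟩
    funext P; simp only [Pi.mul_apply]; ring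
  · refine span_mul_mem h2 (hx s') ?_
    rintro _ ⟨i', j', a1', a2', a3', rfl⟩ _ rfl
    refine Submodule.subset_span ⟨i' + s', j', by omega, by nlinarith, by nlinarith, ?_⟩
    funext P; simp only [Pi.mul_apply]; ring

lemma GoodFn.prod {q : ℕ} {F : Type*} [Field F] {s b : ℕ} {κ : Type*} (A : Finset κ)
    (h : κ → F × F → F)
    (H : ∀ k, GoodFn q s b (h k)) : GoodFn q (A.card * s) (A.card * b) (∏ k ∈ A, h k) := by
  classical
  induction A using Finset.induction_on with
  | empty => simpa using GoodFn.one q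
  | insert k A hk ih =>
    rw [Finset.prod_insert hk, Finset.card_insert_of_notMem hk]
    have := (H k).mul ih
    convert this using 1 <;> ring

lemma exists_points (q : ℕ) (hq : 2 ≤ q) (hpp : IsPrimePow q) (F : Type*) [Field F] [Fintype F]
    (hF : Fintype.card F = q ^ 2) (s b : ℕ) (hbs : b ≤ s) (hsq : s < q) :
    ∃ Z : Finset (F × F), (∀ P ∈ Z, P.2 ^ q + P.2 = P.1 ^ (q+1) ∧ P.2 ≠ 0) ∧
      s * q = b + Z.card ∧ ∃ h, GoodFn q s b h ∧ ∀ P ∈ Z, h P = 0 := by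
  classical
  obtain ⟨k, ε, hε, hb⟩ : ∃ k ε, ε < 2 ∧ b = k * 2 + ε := ⟨b / 2, b % 2, by omega, by omega⟩
  obtain ⟨hμ, hfib⟩ := norm_count q hq F hF
  set μ := Finset.univ.filter fun w : F => w ^ (q+1) = 1
  obtain ⟨W', hW'sub, hW'card⟩ := Finset.exists_subset_card_eq (s := (μ.erase 1).erase (-1)) (n := k + 1) (by
    have h1 := Finset.pred_card_le_card_erase (s := μ) (a := 1)
    have h2 := Finset.pred_card_le_card_erase (s := μ.erase 1) (a := -1)
    omega)
  obtain ⟨w0, hw0⟩ : W'.Nonempty := Finset.card_pos.1 (by omega)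
  have hW' : ∀ w ∈ W', w ^ (q+1) = 1 ∧ w ≠ 1 ∧ w ≠ -1 := by
    intro w hw
    have := hW'sub hw
    simp [μ] at this
    tauto
  set W := W'.erase w0 with hWdef
  have hWcard : W.card = k := by rw [hWdef, Finset.card_erase_of_mem hw0]; omega
  have hW : ∀ w ∈ W, w ^ (q+1) = 1 ∧ w ≠ 1 ∧ w ≠ -1 ∧ w ≠ w0 := by
    intro w hw
    have h1 := Finset.mem_erase.1 hw
    have h2 := hW' w h1.2
    tauto
  obtain ⟨A, hAsub, hAcard⟩ := Finset.exists_subset_card_eq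
    (s := Finset.univ.filter fun x : F => x ≠ 0 ∧ x ^ (q-1) = w0) (n := s - b) (by
      rw [hfib w0 (hW' w0 hw0).1]; omega)
  have hA : ∀ α ∈ A, α ≠ 0 ∧ α ^ (q-1) = w0 := by
    intro α hα
    simpa using hAsub hα
  have hw1 : ∀ w : F, w ≠ -1 → 1 + w ≠ 0 := by
    intro w h h2
    exact h (by linear_combination h2)
  let Zc : F → Finset (F × F) := fun w =>
    (Finset.univ.filter fun x : F => x ≠ 0 ∧ (x ^ (q-1) = 1 ∨ x ^ (q-1) = w)).image
      fun x => (x, x ^ 2 * w / (1 + w))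
  let Zl : F → Finset (F × F) := fun α =>
    (Finset.univ.filter fun v : F => v ^ q + v = α ^ (q+1)).image fun v => (α, v)
  have hZccard : ∀ w ∈ W, (Zc w).card = 2 * (q-1) := by
    intro w hw
    simp only [Zc]
    rw [Finset.card_image_of_injective _ (fun x y h => by simpa using (Prod.ext_iff.1 h).1)]
    have : (Finset.univ.filter fun x : F => x ≠ 0 ∧ (x ^ (q-1) = 1 ∨ x ^ (q-1) = w)) =
        (Finset.univ.filter fun x : F => x ≠ 0 ∧ x ^ (q-1) = 1) ∪
        (Finset.univ.filter fun x : F => x ≠ 0 ∧ x ^ (q-1) = w) := by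
      ext x; simp; tauto
    rw [this, Finset.card_union_of_disjoint, hfib 1 (by simp), hfib w (hW w hw).1]
    · ring
    · rw [Finset.disjoint_left]
      intro x hx hx'
      simp at hx hx'
      exact (hW w hw).2.1 (hx'.2.symm.trans hx.2)
  have hZlcard : ∀ α, (Zl α).card = q := by
    intro α
    simp only [Zl]
    rw [Finset.card_image_of_injective _ (fun x y h => by simpa using (Prod.ext_iff.1 h).2)]
    exact trace_count q hq hpp F hF α
  let Z1 := W.biUnion Zc
  let Z2 : Finset (F × F) := if ε = 0 then ∅ else (Zl 0).erase (0, 0)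
  let Z3 := A.biUnion Zl
  have hmemc : ∀ w P, P ∈ Zc w → P.1 ≠ 0 ∧ (P.1 ^ (q-1) = 1 ∨ P.1 ^ (q-1) = w) ∧
      P.2 = P.1 ^ 2 * w / (1 + w) := by
    intro w P hP
    simp only [Zc, Finset.mem_image, Finset.mem_filter] at hP
    obtain ⟨x, ⟨-, hx1, hx2⟩, rfl⟩ := hP
    exact ⟨hx1, hx2, rfl⟩
  have hmeml : ∀ α P, P ∈ Zl α → P.1 = α ∧ P.2 ^ q + P.2 = α ^ (q+1) := by
    intro w P hP
    simp only [Zl, Finset.mem_image, Finset.mem_filter] at hP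
    obtain ⟨x, ⟨-, hx1⟩, rfl⟩ := hP
    exact ⟨rfl, hx1⟩
  have hmem1 : ∀ P ∈ Z1, ∃ w ∈ W, P ∈ Zc w := by
    intro P hP; simpa [Z1] using hP
  have hmem3 : ∀ P ∈ Z3, ∃ α ∈ A, P ∈ Zl α := by
    intro P hP; simpa [Z3] using hP
  have hmem2 : ∀ P ∈ Z2, ε ≠ 0 ∧ P ∈ Zl 0 ∧ P ≠ (0, 0) := by
    intro P hP
    simp only [Z2] at hP
    split_ifs at hP with h
    · simp at hP
    · rw [Finset.mem_erase] at hP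
      tauto
  have hZ1card : Z1.card = k * (2 * (q-1)) := by
    rw [Finset.card_biUnion, Finset.sum_congr rfl hZccard, Finset.sum_const, hWcard, smul_eq_mul]
    intro w hw w' hw' hne
    rw [Function.onFun, Finset.disjoint_left]
    intro P hP hP'
    obtain ⟨h1, -, h2⟩ := hmemc _ _ hP
    obtain ⟨-, -, h3⟩ := hmemc _ _ hP'
    apply hne
    have n1 := hw1 w (hW w hw).2.2.1
    have n2 := hw1 w' (hW w' hw').2.2.1
    rw [h2] at h3
    field_simp at h3
    linear_combination h3
  have hZ2card : Z2.card = ε * (q-1) := by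
    simp only [Z2]
    split_ifs with h
    · simp [h]
    · rw [Finset.card_erase_of_mem, hZlcard]
      · have : ε = 1 := by omega
        rw [this, one_mul]
      · simp only [Zl, Finset.mem_image, Finset.mem_filter]
        exact ⟨0, ⟨by simp, by rw [zero_pow (by omega), zero_pow (by omega), add_zero]⟩, rfl⟩
  have hZ3card : Z3.card = (s - b) * q := by
    rw [Finset.card_biUnion, Finset.sum_congr rfl (fun α _ => hZlcard α), Finset.sum_const, hAcard, smul_eq_mul]
    intro w hw w' hw' hne
    rw [Function.onFun, Finset.disjoint_left]
    intro P hP hP'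
    exact hne ((hmeml _ _ hP).1.symm.trans (hmeml _ _ hP').1)
  have hd12 : Disjoint Z1 Z2 := by
    rw [Finset.disjoint_left]
    intro P hP hP'
    obtain ⟨w, hw, h⟩ := hmem1 P hP
    exact (hmemc _ _ h).1 (hmeml _ _ (hmem2 P hP').2.1).1
  have hd123 : Disjoint (Z1 ∪ Z2) Z3 := by
    rw [Finset.disjoint_left]
    intro P hP hP'
    obtain ⟨α, hα, h⟩ := hmem3 P hP'
    have e := (hmeml _ _ h).1
    obtain ⟨hα1, hα2⟩ := hA α hα
    rcases Finset.mem_union.1 hP with hP | hP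
    · obtain ⟨w, hw, h'⟩ := hmem1 P hP
      obtain ⟨-, h3, -⟩ := hmemc _ _ h'
      rw [e, hα2] at h3
      rcases h3 with h3 | h3
      · exact (hW' w0 hw0).2.1 h3
      · exact (hW w hw).2.2.2 h3.symm
    · exact hα1 (e.symm.trans (hmeml _ _ (hmem2 P hP).2.1).1)
  have hv0 : ∀ P : F × F, P.2 ^ q + P.2 = P.1 ^ (q+1) → P ≠ (0, 0) → P.2 ≠ 0 := by
    intro P hP hne h0
    rw [h0, zero_pow (by omega), add_zero] at hP
    exact hne (Prod.ext (pow_eq_zero_iff (by omega) |>.1 hP.symm) h0)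
  let h : F × F → F := (∏ w ∈ W, fun P : F × F => P.1 ^ 2 - ((1 + w) / w) * P.2) *
    (∏ _i ∈ Finset.range ε, fun P : F × F => P.1) * (∏ α ∈ A, fun P : F × F => P.1 - α)
  refine ⟨Z1 ∪ Z2 ∪ Z3, ?_, ?_, h, ?_, ?_⟩
  · intro P hP
    rcases Finset.mem_union.1 hP with hP | hP
    · rcases Finset.mem_union.1 hP with hP | hP
      · obtain ⟨w, hw, h'⟩ := hmem1 P hP
        obtain ⟨h1, h2, h3⟩ := hmemc _ _ h'
        have n1 := hw1 w (hW w hw).2.2.1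
        have hwn := (hW w hw).1
        have hcurve : P.2 ^ q + P.2 = P.1 ^ (q+1) := by
          have hwq : w ^ q * w = 1 := by rw [← pow_succ]; exact hwn
          have hw0 : w ≠ 0 := right_ne_zero_of_mul_eq_one hwq
          have hwq' : w ^ q = 1 / w := by field_simp; exact hwq
          have ht : P.1 ^ q = P.1 ^ (q-1) * P.1 := by
            rw [← pow_succ]; congr 1; omega
          have hP2q : P.2 ^ q = (P.1 ^ q) ^ 2 / (1 + w) := by
            rw [h3, div_pow, mul_pow, frob_add q hpp F hF, one_pow, hwq', ← pow_mul, ← pow_mul, mul_comm q 2]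
            have n2 : w + 1 ≠ 0 := by rwa [add_comm]
            have n3 : 1 + 1 / w = (1 + w) / w := by field_simp; ring
            rw [n3]
            field_simp
          rw [hP2q, h3, pow_succ P.1 q, ht]
          generalize P.1 ^ (q-1) = t at h2 ⊢
          field_simp
          rcases h2 with rfl | rfl <;> ring
        exact ⟨hcurve, hv0 P hcurve fun h => h1 (by rw [h])⟩
      · obtain ⟨-, h1, h2⟩ := hmem2 P hP
        obtain ⟨h3, h4⟩ := hmeml _ _ h1
        rw [← h3] at h4
        exact ⟨h4, hv0 P h4 h2⟩
    · obtain ⟨α, hα, h'⟩ := hmem3 P hP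
      obtain ⟨h3, h4⟩ := hmeml _ _ h'
      have := (hA α hα).1
      rw [← h3] at h4 this
      exact ⟨h4, hv0 P h4 fun h => this (by rw [h])⟩
  · rw [Finset.card_union_of_disjoint hd123, Finset.card_union_of_disjoint hd12, hZ1card, hZ2card, hZ3card]
    obtain ⟨d, rfl⟩ := Nat.exists_eq_add_of_le hbs
    rw [Nat.add_sub_cancel_left, hb]
    obtain ⟨r, rfl⟩ := Nat.exists_eq_add_of_le' (show 1 ≤ q by omega)
    rw [Nat.add_sub_cancel]
    ring
  · have g1 := GoodFn.prod (q := q) W (fun w => fun P : F × F => P.1 ^ 2 - ((1 + w) / w) * P.2)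
      (fun w => GoodFn.conic q hq _)
    have g2 := GoodFn.prod (q := q) (Finset.range ε) (fun _ => fun P : F × F => P.1)
      (fun w => GoodFn.x q)
    have g3 := GoodFn.prod (q := q) A (fun α => fun P : F × F => P.1 - α)
      (fun w => GoodFn.line q hq _)
    have g := (g1.mul g2).mul g3
    rw [hWcard, hAcard, Finset.card_range] at g
    convert g using 1 <;> omega
  · intro P hP
    simp only [h, Pi.mul_apply, Finset.prod_apply]
    rcases Finset.mem_union.1 hP with hP | hP
    · rcases Finset.mem_union.1 hP with hP | hP
      · obtain ⟨w, hw, h'⟩ := hmem1 P hP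
        obtain ⟨h1, h2, h3⟩ := hmemc _ _ h'
        have n1 := hw1 w (hW w hw).2.2.1
        have hw0 : w ≠ 0 := by
          intro h0
          have := (hW w hw).1
          rw [h0, zero_pow (by omega)] at this
          exact zero_ne_one this
        rw [Finset.prod_eq_zero hw, zero_mul, zero_mul]
        rw [h3]
        field_simp
        ring
      · obtain ⟨h0, h1, h2⟩ := hmem2 P hP
        rw [Finset.prod_eq_zero (s := Finset.range ε) (i := 0) (by simp; omega) (hmeml _ _ h1).1, mul_zero, zero_mul]
    · obtain ⟨α, hα, h'⟩ := hmem3 P hP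
      rw [Finset.prod_eq_zero (s := A) hα, mul_zero]
      rw [(hmeml _ _ h').1, sub_self]

lemma upper_points (q : ℕ) (hq : 2 ≤ q) (hpp : IsPrimePow q) (F : Type*) [Field F] [Fintype F]
    (hF : Fintype.card F = q ^ 2) (s b a1 : ℕ) (hs : 1 ≤ s) (hsa : s < a1) (ha : a1 ≤ q)
    (hbs : b ≤ s) :
    ∃ (Z : Finset (F × F)) (c : Z → F), (∀ P ∈ Z, P.2 ^ q + P.2 = P.1 ^ (q+1) ∧ P.2 ≠ 0) ∧
      s * q = b + Z.card ∧ c ≠ 0 ∧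
      ∀ i j, i ≤ q → (i < b → 1 ≤ j) → i + j + (if i < a1 then 1 else 0) ≤ q - 2 + s →
      ∑ P, c P * (P.1.1 ^ i * P.1.2 ^ j) = 0 := by
  obtain ⟨Z, hZ, hcard, h, hgood, hh⟩ := exists_points q hq hpp F hF s b hbs (by omega)
  have hrel : (fun P : Z => P.1.1 ^ s) ∈ Submodule.span F {g : Z → F | ∃ e f, e ≤ s ∧
      (e < b → 1 ≤ f) ∧ q * e + (q+1) * f < s * q ∧ g = fun P => P.1.1 ^ e * P.1.2 ^ f} := by
    have hmem := Submodule.mem_map_of_mem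
      (f := LinearMap.funLeft F F (fun P : Z => P.1)) (Submodule.neg_mem _ hgood.2)
    rw [Submodule.map_span] at hmem
    have e : LinearMap.funLeft F F (fun P : Z => P.1) (-(h - fun P => P.1 ^ s)) =
        fun P : Z => P.1.1 ^ s := by
      funext P
      simp [LinearMap.funLeft_apply, hh P.1 P.2]
    rw [e] at hmem
    refine Submodule.span_mono ?_ hmem
    rintro _ ⟨_, ⟨e, f, h1, h2, h3, rfl⟩, rfl⟩
    refine ⟨e, f, h1, fun h => ?_, h3, ?_⟩
    · by_contra hf
      have : f = 0 := by omega
      subst this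
      omega
    · funext P
      simp [LinearMap.funLeft_apply]
  obtain ⟨c, hc, hc2⟩ := upper_exists (ι := Z) q b s a1 (fun P => P.1.1) (fun P => P.1.2)
    (fun P => (hZ P.1 P.2).1) hq hs hsa ha hbs hrel (by simp [hcard])
  exact ⟨Z, c, hZ, hcard, hc, hc2⟩

lemma mem_S_iff (q : ℕ) (hq : 2 ≤ q) (a₀ b₀ : ℤ) (s a1 b1 : ℕ) (ha : a1 ≤ q) (hb : b1 ≤ q)
    (hs : a₀ + b₀ = s) (i j : ℤ) :
    (i, j) ∈ S q (((q:ℤ) - 2) * ((q:ℤ)+1) + (a₀ * ((q:ℤ)+1) - a1)) (b₀ * ((q:ℤ)+1) - b1) ↔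
    ∃ i' j' : ℕ, i = i' ∧ j + b₀ = j' ∧ i' ≤ q ∧ (i' < b1 → 1 ≤ j') ∧
      i' + j' + (if i' < a1 then 1 else 0) ≤ q - 2 + s := by
  simp only [S, Set.mem_ofPred_eq]
  constructor
  · rintro ⟨h1, h2, h3, h4⟩
    lift i to ℕ using h1
    have hj : 0 ≤ j + b₀ := by
      by_contra hneg
      have : j + b₀ ≤ -1 := by omega
      nlinarith
    obtain ⟨j', hj'⟩ := Int.eq_ofNat_of_zero_le hj
    refine ⟨i, j', rfl, hj', by omega, ?_, ?_⟩
    · intro hib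
      by_contra hc
      have : j + b₀ = 0 := by omega
      have : ((q:ℤ)+1) * (j + b₀) = 0 := by rw [this, mul_zero]
      nlinarith
    · rw [← ord_le_iff q a1 (q-2+s) i j' (by omega) ha]
      zify [hq]
      rw [← hs, ← hj']
      linarith
  · rintro ⟨i', j', rfl, hj, h1, h2, h3⟩
    rw [← ord_le_iff q a1 (q-2+s) i' j' (by omega) ha] at h3
    zify [hq] at h3
    rw [← hs, ← hj] at h3
    refine ⟨by omega, by omega, by linarith, ?_⟩
    have : (b1:ℤ) ≤ i' + ((q:ℤ)+1) * (j + b₀) := by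
      rw [hj]
      by_cases h : i' < b1
      · have : (1:ℤ) ≤ j' := by exact_mod_cast h2 h
        nlinarith
      · have : (0:ℤ) ≤ ((q:ℤ)+1) * j' := by positivity
        omega
    linarith

lemma mem_dual_iff (q : ℕ) (F : Type) [Field F] [Fintype F] (m n : ℤ) (c : ↥(Dset q F) → F) :
    c ∈ dualCode q F m n ↔ ∀ i j, (i, j) ∈ S q m n →
      ∑ P : ↥(Dset q F), c P * (P.1.1 ^ i * P.1.2 ^ j) = 0 := by
  constructor
  · intro h i j hij
    exact h (evalVec q F (i, j)) (Submodule.subset_span ⟨_, hij, rfl⟩)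
  · intro h w hw
    induction hw using Submodule.span_induction with
    | mem x hx =>
      obtain ⟨⟨i, j⟩, hij, rfl⟩ := hx
      exact h i j hij
    | zero => simp
    | add x y _ _ hx hy =>
      simp only [Pi.add_apply, mul_add, Finset.sum_add_distrib, hx, hy, add_zero]
    | smul a x _ hx =>
      simp only [Pi.smul_apply, smul_eq_mul]
      rw [← mul_zero a, ← hx, Finset.mul_sum]
      exact Finset.sum_congr rfl fun P _ => by ring

lemma Dset_snd_ne (q : ℕ) (hq : 2 ≤ q) (F : Type) [Field F] (P : ↥(Dset q F)) : P.1.2 ≠ 0 := by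
  intro h0
  obtain ⟨hP, hne⟩ := P.2
  rw [h0, zero_pow (by omega), add_zero] at hP
  exact hne (Prod.ext (pow_eq_zero_iff (by omega) |>.1 hP.symm) h0)

/-- Theorem 3.3, case 2: if `0 ≤ b₁ ≤ a₀ + b₀ < a₁`, then
`d(C(K + a P∞ + b P₀)^⊥) = d* + a₁ - (a₀ + b₀)`, where `K = (q-2)(q+1) P∞`. -/
theorem minDist_case2 (q : ℕ) (hq : 2 ≤ q) (hpp : IsPrimePow q)
    (F : Type) [Field F] [Fintype F] (hF : Fintype.card F = q ^ 2)
    (a₀ b₀ a₁ b₁ a b : ℤ)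
    (ha₁ : 0 ≤ a₁ ∧ a₁ ≤ (q : ℤ)) (hb₁ : 0 ≤ b₁ ∧ b₁ ≤ (q : ℤ))
    (ha : a = a₀ * ((q : ℤ) + 1) - a₁) (hb : b = b₀ * ((q : ℤ) + 1) - b₁)
    (hdeg : 0 ≤ a + b ∧ a + b ≤ (q : ℤ) ^ 3 - 1)
    (hrange : (q : ℤ) < a + b ∨ (a + b ≤ (q : ℤ) ∧ a₁ ≠ 0 ∧ b₁ ≠ 0))
    (hcase : b₁ ≤ a₀ + b₀ ∧ a₀ + b₀ < a₁) :
    (minDist q F (((q : ℤ) - 2) * ((q : ℤ) + 1) + a) b : ℤ) = a + b + a₁ - (a₀ + b₀) := by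
  classical
  obtain ⟨s, hs⟩ : ∃ s : ℕ, a₀ + b₀ = s := Int.eq_ofNat_of_zero_le (by omega)
  obtain ⟨a1, rfl⟩ := Int.eq_ofNat_of_zero_le ha₁.1
  obtain ⟨b1, rfl⟩ := Int.eq_ofNat_of_zero_le hb₁.1
  have ha1 : a1 ≤ q := by omega
  have hb1 : b1 ≤ s := by omega
  have hsa : s < a1 := by omega
  have hs1 : 1 ≤ s := by
    by_contra h
    have h0 : a₀ + b₀ = 0 := by omega
    have : (a₀ + b₀) * ((q:ℤ)+1) = 0 := by rw [h0, zero_mul]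
    have h1 := hdeg.1
    rw [ha, hb] at h1
    have : (0:ℤ) < a1 := by omega
    nlinarith
  have hgoal : a + b + a1 - (a₀ + b₀) = s * q - b1 := by
    rw [ha, hb, ← hs]; ring
  rw [hgoal]
  subst ha hb
  set m := ((q : ℤ) - 2) * ((q : ℤ) + 1) + (a₀ * ((q : ℤ) + 1) - a1) with hm
  set n := b₀ * ((q : ℤ) + 1) - b1 with hn
  have hS := mem_S_iff q hq a₀ b₀ s a1 b1 ha1 (by omega) hs
  have hv := Dset_snd_ne q hq F
  -- lower bound for every nonzero dual word
  have hlow : ∀ c ∈ dualCode q F m n, c ≠ 0 → s * q ≤ b1 + wt c := by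
    intro c hc hc0
    rw [mem_dual_iff] at hc
    let c' : ↥(Dset q F) → F := fun P => c P * P.1.2 ^ (-b₀)
    have hsupp : ∀ P, c' P ≠ 0 ↔ c P ≠ 0 := by
      intro P
      simp [c', zpow_ne_zero _ (hv P)]
    have hc'0 : c' ≠ 0 := by
      obtain ⟨P, hP⟩ := Function.ne_iff.1 hc0
      exact Function.ne_iff.2 ⟨P, (hsupp P).2 hP⟩
    have hH : ∀ P : ↥(Dset q F), P.1.2 ^ q + P.1.2 = P.1.1 ^ (q+1) := fun P => P.2.1
    have := lower_bound q b1 s a1 (fun P : ↥(Dset q F) => P.1.1) (fun P => P.1.2) c' hH hq hs1 hsa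
      ha1 ?_ (exists_nonzero q _ _ c' hH hq (fun P Q h1 h2 => Subtype.ext (Prod.ext h1 h2)) hv hc'0)
    · have e : Nat.card {P // c' P ≠ 0} = wt c := by
        unfold wt
        simp only [hsupp]
      rwa [e] at this
    · intro i j h1 h2 h3
      have := hc i (j - b₀) ((hS _ _).2 ⟨i, j, rfl, by ring, h1, h2, h3⟩)
      rw [← this]
      refine Finset.sum_congr rfl fun P _ => ?_
      simp only [c']
      rw [sub_eq_add_neg, zpow_add₀ (hv P), zpow_natCast, zpow_natCast]
      ring
  -- a word attaining the bound
  have hup : ∃ c ∈ dualCode q F m n, c ≠ 0 ∧ b1 + wt c ≤ s * q := by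
    obtain ⟨Z, c, hZ, hcard, hc0, hc⟩ := upper_points q hq hpp F hF s b1 a1 hs1 hsa ha1 hb1
    let d : ↥(Dset q F) → F := fun P =>
      if h : P.1 ∈ Z then c ⟨P.1, h⟩ * P.1.2 ^ b₀ else 0
    have hZD : ∀ P ∈ Z, P ∈ Dset q F := fun P hP =>
      ⟨(hZ P hP).1, fun h => (hZ P hP).2 (by rw [h]; rfl)⟩
    refine ⟨d, ?_, ?_, ?_⟩
    · rw [mem_dual_iff]
      intro i j hij
      obtain ⟨i', j', rfl, hj, h1, h2, h3⟩ := (hS _ _).1 hij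
      rw [← hc i' j' h1 h2 h3]
      symm
      refine Finset.sum_of_injOn (fun P : Z => (⟨P.1, hZD _ P.2⟩ : ↥(Dset q F))) ?_ ?_ ?_ ?_
      · intro P _ Q _ h
        exact Subtype.ext (congrArg (fun x : ↥(Dset q F) => x.1) h)
      · intro P _; simp
      · intro P _ hP
        have : P.1 ∉ Z := fun h => hP ⟨⟨P.1, h⟩, by simp, rfl⟩
        simp only [d, dif_neg this, zero_mul]
      · intro P _
        simp only [d, dif_pos P.2]
        have hne := (hZ _ P.2).2
        have : (P.1.2 : F) ^ j' = P.1.2 ^ b₀ * P.1.2 ^ j := by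
          rw [← zpow_add₀ hne, ← zpow_natCast, ← hj, add_comm]
        rw [this, zpow_natCast]
        ring
    · obtain ⟨P, hP⟩ := Function.ne_iff.1 hc0
      refine Function.ne_iff.2 ⟨⟨P.1, hZD _ P.2⟩, ?_⟩
      simp only [d, dif_pos P.2]
      exact mul_ne_zero hP (zpow_ne_zero _ (hZ _ P.2).2)
    · rw [hcard]
      have : wt d ≤ Nat.card Z := by
        unfold wt
        have hin : ∀ P : {P // d P ≠ 0}, P.1.1 ∈ Z := by
          intro P
          by_contra h
          exact P.2 (by simp only [d, dif_neg h])
        apply Nat.card_le_card_of_injective (fun P : {P // d P ≠ 0} => (⟨P.1.1, hin P⟩ : Z))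
        intro P Q h
        exact Subtype.ext (Subtype.ext (congrArg (fun x : Z => x.1) h))
      simpa using this
  obtain ⟨c, hc, hc0, hcw⟩ := hup
  have h1 : minDist q F m n ≤ wt c := Nat.sInf_le ⟨c, hc, hc0, rfl⟩
  obtain ⟨c', hc', hc'0, hw'⟩ : minDist q F m n ∈ {w | ∃ c ∈ dualCode q F m n, c ≠ 0 ∧ wt c = w} :=
    Nat.sInf_mem ⟨_, c, hc, hc0, rfl⟩
  have h2 := hlow c' hc' hc'0
  rw [hw'] at h2
  have h3 : s * q = b1 + minDist q F m n := by omega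
  have h4 : (s * q : ℤ) = b1 + minDist q F m n := by exact_mod_cast h3
  linarith

end HermitianTwoPoint
end

section
/- Let a₀, b₀, a₁, b₁ be integers with 0 ≤ a₁ ≤ q and 0 ≤ b₁ ≤ q, and set a = a₀(q+1) − a₁, b = b₀(q+1) − b₁ and d* = a + b. Assume 0 ≤ a + b ≤ q³ − 1, and assume either a + b > q, or (a + b ≤ q and a₁ ≠ 0 and b₁ ≠ 0). If 0 ≤ a₁ ≤ a₀ + b₀ < b₁, then d(C((q−2)(q+1) + a, b)^⊥) = d* + b₁ − (a₀ + b₀). (Theorem 3.3, case 2′.) -/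
open scoped BigOperators

namespace HermitianTwoPoint

section Aux

set_option linter.unusedSectionVars false

variable {q : ℕ} {F : Type} [Field F] [Fintype F]

/-- Laurent monomials evaluated on the points of the curve. -/
def mono (q : ℕ) (F : Type) [Field F] (i : ℕ) (j : ℤ) : ↥(Dset q F) → F :=
  fun P => (P : F × F).1 ^ i * (P : F × F).2 ^ j

/-- Pairing of a word with a monomial. -/
noncomputable def pair (c : ↥(Dset q F) → F) (i : ℕ) (j : ℤ) : F :=
  ∑ P, c P * mono q F i j P

lemma snd_ne (hq : 2 ≤ q) (P : ↥(Dset q F)) : (P : F × F).2 ≠ 0 := by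
  obtain ⟨⟨x, y⟩, h, hne⟩ := P
  simp only at h ⊢
  rintro rfl
  apply hne
  have : x ^ (q + 1) = 0 := by rw [← h]; simp; omega
  have hx : x = 0 := by simpa using this
  rw [hx]; rfl

lemma curve (P : ↥(Dset q F)) :
    (P : F × F).1 ^ (q + 1) = (P : F × F).2 ^ q + (P : F × F).2 := P.2.1.symm

lemma mono_red (hq : 2 ≤ q) (i : ℕ) (j : ℤ) :
    mono q F (i + (q + 1)) j = mono q F i (j + q) + mono q F i (j + 1) := by
  funext P
  have hy := snd_ne hq P
  simp only [mono, Pi.add_apply]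
  rw [pow_add, curve, zpow_add₀ hy, zpow_add₀ hy, zpow_natCast, zpow_one]
  ring

lemma mono_mul (hq : 2 ≤ q) (i i' : ℕ) (j j' : ℤ) :
    mono q F i j * mono q F i' j' = mono q F (i + i') (j + j') := by
  funext P
  have hy := snd_ne hq P
  simp only [mono, Pi.mul_apply]
  rw [pow_add, zpow_add₀ hy]
  ring

lemma pair_red (hq : 2 ≤ q) (c : ↥(Dset q F) → F) (i : ℕ) (j : ℤ) :
    pair c (i + (q + 1)) j = pair c i (j + q) + pair c i (j + 1) := by
  simp only [pair, mono_red hq, Pi.add_apply, mul_add, Finset.sum_add_distrib]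

/-- vanishing on reduced monomials implies vanishing on all monomials. -/
lemma pair_ext (hq : 2 ≤ q) (c : ↥(Dset q F) → F) (M r : ℤ)
    (h : ∀ i : ℕ, i ≤ q → ∀ j : ℤ, (q : ℤ) * i + (q + 1) * j ≤ M →
      r < i + ((q : ℤ) + 1) * j → pair c i j = 0) :
    ∀ i : ℕ, ∀ j : ℤ, (q : ℤ) * i + (q + 1) * j ≤ M →
      r < i + ((q : ℤ) + 1) * j → pair c i j = 0 := by
  intro i
  induction i using Nat.strong_induction_on with
  | _ i ih =>
    intro j h1 h2
    by_cases hi : i ≤ q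
    · exact h i hi j h1 h2
    · obtain ⟨k, rfl⟩ : ∃ k, i = k + (q + 1) := ⟨i - (q + 1), by omega⟩
      have hq' : (2 : ℤ) ≤ q := by exact_mod_cast hq
      push_cast at h1 h2
      rw [pair_red hq, ih k (by omega) (j + q) (by nlinarith) (by nlinarith),
        ih k (by omega) (j + 1) (by nlinarith) (by nlinarith), add_zero]

lemma exists_pair_ne (hq : 2 ≤ q) (c : ↥(Dset q F) → F) (hc : c ≠ 0) :
    ∃ i : ℕ, i ≤ q ∧ ∃ j : ℤ, pair c i j ≠ 0 := by
  by_contra! hcon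
  have hall : ∀ i : ℕ, ∀ j : ℤ, pair c i j = 0 := by
    intro i j
    exact pair_ext hq c (max ((q : ℤ) * i + (q + 1) * j) 0) (i + ((q : ℤ) + 1) * j - 1)
      (fun i hi j _ _ => hcon i hi j) i j (le_max_left _ _) (by linarith)
  apply hc
  funext P
  classical
  have hpoly : ∀ p r : Polynomial F,
      ∑ R : ↥(Dset q F), c R * (p.eval (R : F × F).1 * r.eval (R : F × F).2) = 0 := by
    intro p r
    simp only [Polynomial.eval_eq_sum_range, Finset.sum_mul_sum]
    simp only [Finset.mul_sum]
    rw [Finset.sum_comm]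
    apply Finset.sum_eq_zero
    intro i _
    rw [Finset.sum_comm]
    apply Finset.sum_eq_zero
    intro j _
    have := hall i j
    simp only [pair, mono, zpow_natCast] at this
    calc _ = p.coeff i * r.coeff j * ∑ R : ↥(Dset q F),
          c R * ((R : F × F).1 ^ i * (R : F × F).2 ^ j) := by
          rw [Finset.mul_sum]
          exact Finset.sum_congr rfl fun R _ => by ring
      _ = 0 := by rw [this, mul_zero]
  have h := hpoly (1 - (Polynomial.X - Polynomial.C (P : F × F).1) ^ (Fintype.card F - 1))
    (1 - (Polynomial.X - Polynomial.C (P : F × F).2) ^ (Fintype.card F - 1))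
  have hcard : Fintype.card F - 1 ≠ 0 := by
    have := Fintype.one_lt_card (α := F); omega
  rw [Finset.sum_eq_single P] at h
  · simpa [hcard] using h
  · intro R _ hR
    have : (R : F × F).1 ≠ (P : F × F).1 ∨ (R : F × F).2 ≠ (P : F × F).2 := by
      by_contra! hh
      exact hR (Subtype.ext (Prod.ext hh.1 hh.2))
    rcases this with hh | hh
    · simp [FiniteField.pow_card_sub_one_eq_one _ (sub_ne_zero.2 hh)]
    · simp [FiniteField.pow_card_sub_one_eq_one _ (sub_ne_zero.2 hh)]
  · simp

/-- The rank argument: triangular pairing gives a lower bound for the weight. -/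
lemma wt_ge {ι : Type} (Λ : Finset ι) (w : ι → ℤ) (hw : Set.InjOn w Λ)
    (c : ↥(Dset q F) → F) (f g : ι → ↥(Dset q F) → F)
    (hd : ∀ p ∈ Λ, ∑ P, c P * (f p P * g p P) ≠ 0)
    (ho : ∀ p ∈ Λ, ∀ p' ∈ Λ, w p' < w p → ∑ P, c P * (f p P * g p' P) = 0) :
    Λ.card ≤ wt c := by
  classical
  have hli : LinearIndependent F (fun p : Λ => fun P : {P // c P ≠ 0} => f p P) := by
    rw [Fintype.linearIndependent_iff]
    intro l hl
    by_contra! hne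
    obtain ⟨p₁, hp₁⟩ := hne
    obtain ⟨p₀, hp₀, hmin⟩ := Finset.exists_min_image
      (Finset.univ.filter fun p : Λ => l p ≠ 0) (fun p => w p) ⟨p₁, by simp [hp₁]⟩
    simp only [Finset.mem_filter, Finset.mem_univ, true_and] at hp₀ hmin
    have hz : ∀ P, c P * (∑ p : Λ, l p * f p P) = 0 := by
      intro P
      by_cases hP : c P = 0
      · simp [hP]
      · have := congrFun hl ⟨P, hP⟩
        simp only [Finset.sum_apply, Pi.smul_apply, smul_eq_mul, Pi.zero_apply] at this
        rw [this, mul_zero]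
    have h0 : ∑ p : Λ, l p * ∑ P, c P * (f p P * g p₀ P) = 0 := by
      simp only [Finset.mul_sum]
      rw [Finset.sum_comm]
      apply Finset.sum_eq_zero
      intro P _
      calc _ = (c P * (∑ p : Λ, l p * f p P)) * g p₀ P := by
            rw [Finset.mul_sum, Finset.sum_mul]
            exact Finset.sum_congr rfl fun p _ => by ring
        _ = 0 := by rw [hz, zero_mul]
    rw [Finset.sum_eq_single p₀] at h0
    · exact (mul_ne_zero hp₀ (hd p₀ p₀.2)) h0
    · intro p _ hp
      by_cases hlp : l p = 0
      · simp [hlp]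
      · have h1 := hmin p hlp
        have h2 : w p₀ ≠ w p := fun e => hp (Subtype.ext (hw p.2 p₀.2 e.symm))
        rw [ho p p.2 p₀ p₀.2 (lt_of_le_of_ne h1 h2), mul_zero]
    · simp
  have := hli.fintype_card_le_finrank
  rw [Module.finrank_fintype_fun_eq_card] at this
  simpa [wt, Nat.card_eq_fintype_card] using this

lemma pair_shift (hq : 2 ≤ q) (hF : Fintype.card F = q ^ 2) (c : ↥(Dset q F) → F)
    (i : ℕ) (j k : ℤ) : pair c i (j + ((q : ℤ) ^ 2 - 1) * k) = pair c i j := by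
  unfold pair mono
  refine Finset.sum_congr rfl fun P _ => ?_
  have hy := snd_ne hq P
  have h1 := FiniteField.pow_card_sub_one_eq_one _ hy
  have h2 : ((q : ℤ) ^ 2 - 1) = ((Fintype.card F - 1 : ℕ) : ℤ) := by
    rw [hF, Nat.cast_sub (Nat.one_le_pow _ _ (by omega))]; push_cast; ring
  rw [zpow_add₀ hy, zpow_mul, h2, zpow_natCast, h1, one_zpow, mul_one]

lemma exists_max (hq : 2 ≤ q) (hF : Fintype.card F = q ^ 2) (c : ↥(Dset q F) → F) (hc : c ≠ 0)
    (M : ℤ) : ∃ i₀ : ℕ, i₀ ≤ q ∧ ∃ j₀ : ℤ, (q : ℤ) * i₀ + (q + 1) * j₀ ≤ M ∧ pair c i₀ j₀ ≠ 0 ∧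
      ∀ i : ℕ, ∀ j : ℤ, (q : ℤ) * i + (q + 1) * j ≤ M →
      i₀ + ((q : ℤ) + 1) * j₀ < i + ((q : ℤ) + 1) * j → pair c i j = 0 := by
  have hq' : (2 : ℤ) ≤ q := by exact_mod_cast hq
  let Pr : ℤ → Prop := fun z => ∃ i : ℕ, i ≤ q ∧ ∃ j : ℤ, (q : ℤ) * i + (q + 1) * j ≤ M ∧
    pair c i j ≠ 0 ∧ z = i + ((q : ℤ) + 1) * j
  have hb : ∃ b : ℤ, ∀ z, Pr z → z ≤ b := by
    refine ⟨M, ?_⟩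
    rintro z ⟨i, hi, j, h1, -, rfl⟩
    have : (0 : ℤ) ≤ i := by positivity
    nlinarith
  have hinh : ∃ z, Pr z := by
    obtain ⟨i, hi, j, hne⟩ := exists_pair_ne hq c hc
    refine ⟨_, i, hi, j + ((q : ℤ) ^ 2 - 1) * (-(|(q : ℤ) * i + (q + 1) * j| + |M|)), ?_, ?_, rfl⟩
    · have h1 := le_abs_self ((q : ℤ) * i + (q + 1) * j)
      have h2 := neg_abs_le M
      have h3 := abs_nonneg ((q : ℤ) * i + (q + 1) * j)
      have h4 := abs_nonneg M
      set A := |(q : ℤ) * i + (q + 1) * j|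
      have h5 : 1 ≤ ((q : ℤ) + 1) * ((q : ℤ) ^ 2 - 1) := by nlinarith
      have h6 : (A + |M|) * 1 ≤ (A + |M|) * (((q : ℤ) + 1) * ((q : ℤ) ^ 2 - 1)) :=
        mul_le_mul_of_nonneg_left h5 (by linarith)
      linarith
    · rw [pair_shift hq hF]; exact hne
  obtain ⟨z, ⟨i₀, hi₀, j₀, h1, h2, rfl⟩, hmax⟩ := Int.exists_greatest_of_bdd hb hinh
  refine ⟨i₀, hi₀, j₀, h1, h2, pair_ext hq c M _ ?_⟩
  intro i hi j h3 h4
  by_contra hne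
  have := hmax _ ⟨i, hi, j, h3, hne, rfl⟩
  linarith

/-- The order bound. -/
lemma order_bound (hq : 2 ≤ q) (c : ↥(Dset q F) → F) (s a₁ i₀ : ℕ) (j₀ : ℤ) (hi₀ : i₀ ≤ q)
    (ha₁ : a₁ ≤ q)
    (hne : pair c i₀ j₀ ≠ 0)
    (hz : ∀ i : ℕ, ∀ j : ℤ, (q : ℤ) * i + (q + 1) * j ≤ ((q : ℤ) - 2 + s) * (q + 1) - a₁ →
      i₀ + ((q : ℤ) + 1) * j₀ < i + ((q : ℤ) + 1) * j → pair c i j = 0) :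
    ∑ i ∈ Finset.range (q + 1), (((q : ℤ) - 2 + s - i₀ - j₀ + if a₁ ≤ i then 1 else 0) + 1 -
      (if i ≤ i₀ then 1 else (q : ℤ) + 1)).toNat ≤ wt c := by
  classical
  have hq' : (2 : ℤ) ≤ q := by exact_mod_cast hq
  set Q : ℤ := (q : ℤ) - 2 + s - i₀ - j₀ with hQ
  let Λ : Finset (Σ _ : ℕ, ℤ) := (Finset.range (q + 1)).sigma fun i =>
    Finset.Icc (if i ≤ i₀ then 1 else (q : ℤ) + 1) (Q + if a₁ ≤ i then 1 else 0)
  have hcard : Λ.card = ∑ i ∈ Finset.range (q + 1), ((Q + if a₁ ≤ i then 1 else 0) + 1 -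
      (if i ≤ i₀ then 1 else (q : ℤ) + 1)).toNat := by
    simp only [Λ, Finset.card_sigma, Int.card_Icc]
  rw [← hcard]
  have hmem : ∀ p ∈ Λ, p.1 ≤ q ∧ (if p.1 ≤ i₀ then 1 else (q : ℤ) + 1) ≤ p.2 ∧
      p.2 ≤ Q + if a₁ ≤ p.1 then 1 else 0 := by
    rintro ⟨i, t⟩ hp
    simp only [Λ, Finset.mem_sigma, Finset.mem_range, Finset.mem_Icc] at hp
    exact ⟨by simp only; omega, hp.2.1, hp.2.2⟩
  -- bounds on pole orders
  have hup : ∀ p ∈ Λ, ((q : ℤ) + 1) * p.2 - p.1 ≤ (q + 1) * (Q + 1) - a₁ := by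
    intro p hp
    obtain ⟨h1, h2, h3⟩ := hmem p hp
    have h1' : (p.1 : ℤ) ≤ q := by exact_mod_cast h1
    have ha' : (a₁ : ℤ) ≤ q := by exact_mod_cast ha₁
    split_ifs at h3 with h4
    · have h4' : (a₁ : ℤ) ≤ p.1 := by exact_mod_cast h4
      nlinarith
    · have : (0 : ℤ) ≤ p.1 := by positivity
      nlinarith
  have hlo : ∀ p ∈ Λ, (q : ℤ) + 1 - i₀ + (if p.1 ≤ i₀ then 0 else ((q : ℤ) - 1) * (q + 1)) ≤
      ((q : ℤ) + 1) * p.2 - p.1 := by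
    intro p hp
    obtain ⟨h1, h2, h3⟩ := hmem p hp
    have h1' : (p.1 : ℤ) ≤ q := by exact_mod_cast h1
    have hi' : (0 : ℤ) ≤ i₀ := by positivity
    split_ifs at h2 ⊢ with h4
    · have h4' : (p.1 : ℤ) ≤ i₀ := by exact_mod_cast h4
      nlinarith
    · nlinarith
  let f : (Σ _ : ℕ, ℤ) → ↥(Dset q F) → F := fun p => mono q F p.1 (p.2 - p.1)
  let g : (Σ _ : ℕ, ℤ) → ↥(Dset q F) → F := fun p =>
    if p.1 ≤ i₀ then mono q F (i₀ - p.1) (j₀ - (p.2 - p.1))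
    else mono q F (i₀ + (q + 1) - p.1) (j₀ - 1 - (p.2 - p.1))
  refine wt_ge Λ (fun p => ((q : ℤ) + 1) * p.2 - q * p.1) ?_ c f g ?_ ?_
  · rintro ⟨i, t⟩ hp ⟨i', t'⟩ hp' h
    have h1 := (hmem _ hp).1
    have h1' := (hmem _ hp').1
    simp only at h h1 h1'
    have h2 : (i : ℤ) - i' = (q + 1) * ((i - t) - (i' - t')) := by linarith
    have h3 : (i : ℤ) ≤ q := by exact_mod_cast h1
    have h3' : (i' : ℤ) ≤ q := by exact_mod_cast h1'
    have h4 : (i : ℤ) - i' = 0 := by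
      apply Int.eq_zero_of_abs_lt_dvd (m := (q : ℤ) + 1) ⟨_, h2⟩
      rw [abs_lt]; constructor <;> omega
    have h5 : i = i' := by omega
    subst h5
    have h6 : t = t' := by
      have : ((q : ℤ) + 1) * (t - t') = 0 := by linarith
      rcases mul_eq_zero.1 this with h | h <;> omega
    rw [h6]
  · intro p hp
    obtain ⟨h1, h2, h3⟩ := hmem p hp
    have hl := hlo p hp
    have hu := hup p hp
    simp only [f, g]
    by_cases h4 : p.1 ≤ i₀
    · simp only [if_pos h4]
      have : ∀ P, mono q F p.1 (p.2 - p.1) P * mono q F (i₀ - p.1) (j₀ - (p.2 - p.1)) P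
          = mono q F i₀ j₀ P := by
        intro P
        rw [← Pi.mul_apply, mono_mul hq]
        rw [show p.1 + (i₀ - p.1) = i₀ by omega,
          show p.2 - p.1 + (j₀ - (p.2 - p.1)) = j₀ by ring]
      simp only [this]
      exact hne
    · simp only [if_neg h4] at hl ⊢
      have : ∀ P, mono q F p.1 (p.2 - p.1) P *
          mono q F (i₀ + (q + 1) - p.1) (j₀ - 1 - (p.2 - p.1)) P
          = mono q F (i₀ + (q + 1)) (j₀ - 1) P := by
        intro P
        rw [← Pi.mul_apply, mono_mul hq]
        rw [show p.1 + (i₀ + (q + 1) - p.1) = i₀ + (q + 1) by omega,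
          show p.2 - p.1 + (j₀ - 1 - (p.2 - p.1)) = j₀ - 1 by ring]
      simp only [this]
      change pair c (i₀ + (q + 1)) (j₀ - 1) ≠ 0
      rw [pair_red hq, hz i₀ (j₀ - 1 + q) (by nlinarith) (by nlinarith), zero_add,
        sub_add_cancel]
      exact hne
  · intro p hp p' hp' hlt
    obtain ⟨h1, h2, h3⟩ := hmem p hp
    obtain ⟨h1', h2', h3'⟩ := hmem p' hp'
    have hl := hlo p' hp'
    have hu := hup p hp
    simp only [f, g]
    have key : ∀ (i' : ℕ) (j' : ℤ), (q : ℤ) * (p.1 + i' : ℕ) + (q + 1) * (p.2 - p.1 + j') ≤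
        ((q : ℤ) - 2 + s) * (q + 1) - a₁ → i₀ + ((q : ℤ) + 1) * j₀ < (p.1 + i' : ℕ) +
        ((q : ℤ) + 1) * (p.2 - p.1 + j') →
        ∑ P, c P * (mono q F p.1 (p.2 - p.1) P * mono q F i' j' P) = 0 := by
      intro i' j' e1 e2
      have := hz _ _ e1 e2
      rw [pair, ← mono_mul hq] at this
      exact this
    by_cases h4 : p'.1 ≤ i₀
    · simp only [if_pos h4] at hl ⊢
      apply key
      · push_cast [Nat.cast_sub h4]; nlinarith
      · push_cast [Nat.cast_sub h4]; nlinarith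
    · simp only [if_neg h4] at hl ⊢
      have h5 : p'.1 ≤ i₀ + (q + 1) := by omega
      apply key
      · push_cast [Nat.cast_sub h5]; nlinarith
      · push_cast [Nat.cast_sub h5]; nlinarith

lemma lower (hq : 2 ≤ q) (hF : Fintype.card F = q ^ 2) (c : ↥(Dset q F) → F) (hc : c ≠ 0)
    (s a₁ b₁ : ℕ) (h1 : a₁ ≤ s) (h2 : s < b₁) (h3 : b₁ ≤ q) (hs : 1 ≤ s)
    (hz : ∀ i : ℕ, i ≤ q → ∀ j : ℤ,
      (q : ℤ) * i + (q + 1) * j ≤ ((q : ℤ) - 2 + s) * (q + 1) - a₁ →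
      b₁ ≤ i + ((q : ℤ) + 1) * j → pair c i j = 0) :
    s * q - a₁ ≤ wt c := by
  obtain ⟨i₀, hi₀, j₀, e1, hne, e2⟩ := exists_max hq hF c hc (((q : ℤ) - 2 + s) * (q + 1) - a₁)
  have hb := order_bound hq c s a₁ i₀ j₀ hi₀ (by omega) hne e2
  refine le_trans ?_ hb
  have hρ : i₀ + ((q : ℤ) + 1) * j₀ < b₁ := by
    by_contra! h
    exact hne (hz i₀ hi₀ j₀ e1 h)
  have hq' : (2 : ℤ) ≤ q := by exact_mod_cast hq
  have hi' : (i₀ : ℤ) ≤ q := by exact_mod_cast hi₀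
  have h1' : (a₁ : ℤ) ≤ s := by exact_mod_cast h1
  have h2' : (s : ℤ) < b₁ := by exact_mod_cast h2
  have h3' : (b₁ : ℤ) ≤ q := by exact_mod_cast h3
  have hs' : (1 : ℤ) ≤ s := by exact_mod_cast hs
  have haq : a₁ ≤ s * q := by nlinarith
  rw [← Nat.cast_le (α := ℤ), Nat.cast_sub haq]
  simp only [Nat.cast_mul, Nat.cast_sum]
  set Q : ℤ := (q : ℤ) - 2 + s - i₀ - j₀ with hQ
  have hsum1 : ∀ n a : ℕ, a ≤ n → ∑ i ∈ Finset.range n, (if a ≤ i then (1 : ℤ) else 0) = n - a := by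
    intro n a h
    induction n, h using Nat.le_induction with
    | base =>
      rw [sub_self]
      exact Finset.sum_eq_zero fun i hi => if_neg (by simpa using hi)
    | succ n hn ih => rw [Finset.sum_range_succ, ih, if_pos hn]; push_cast; ring
  by_cases hcase : i₀ + ((q : ℤ) + 1) * j₀ < s
  · calc ((s : ℤ) * q - a₁) ≤ ∑ i ∈ Finset.range (q + 1),
          (Q + (if a₁ ≤ i then 1 else 0) - q * (if i₀ + 1 ≤ i then 1 else 0)) := by
          rw [Finset.sum_sub_distrib, Finset.sum_add_distrib, ← Finset.mul_sum,
            hsum1 _ _ (by omega), hsum1 _ _ (by omega)]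
          simp only [Finset.sum_const, Finset.card_range, nsmul_eq_mul]
          push_cast
          nlinarith
      _ ≤ _ := by
          apply Finset.sum_le_sum
          intro i hi
          refine le_trans (le_of_eq ?_) (Int.self_le_toNat _)
          split_ifs <;> first | omega | ring
  · have hj0 : j₀ = 0 := by
      push Not at hcase
      have hj1 : j₀ < 1 := by
        by_contra! h
        have : (0 : ℤ) ≤ i₀ := by positivity
        nlinarith
      have hj2 : -1 < j₀ := by
        by_contra! h
        nlinarith
      omega
    subst hj0
    simp only [mul_zero, add_zero, not_lt] at hcase hρ
    calc ((s : ℤ) * q - a₁) ≤ ∑ i ∈ Finset.range (i₀ + 1),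
          (Q + (if a₁ ≤ i then 1 else 0)) := by
          rw [Finset.sum_add_distrib, hsum1 _ _ (by omega)]
          simp only [Finset.sum_const, Finset.card_range, nsmul_eq_mul]
          push_cast
          nlinarith
      _ ≤ ∑ i ∈ Finset.range (i₀ + 1), (((Q + if a₁ ≤ i then 1 else 0) + 1 -
      (if i ≤ i₀ then 1 else (q : ℤ) + 1)).toNat : ℤ) := by
          apply Finset.sum_le_sum
          intro i hi
          have hi2 : i ≤ i₀ := by simp at hi; omega
          refine le_trans (le_of_eq ?_) (Int.self_le_toNat _)
          rw [if_pos hi2]; ring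
      _ ≤ _ := by
          apply Finset.sum_le_sum_of_subset_of_nonneg
          · intro i hi
            simp at hi ⊢; omega
          · intros; positivity

/-- Two-step filtration by orders at the two points. -/
def Fil (q : ℕ) (F : Type) [Field F] (v n : ℤ) : Submodule F (↥(Dset q F) → F) :=
  Submodule.span F {g | ∃ (i : ℕ) (j : ℤ), v ≤ i + ((q : ℤ) + 1) * j ∧
    (q : ℤ) * i + (q + 1) * j ≤ n ∧ g = mono q F i j}

lemma mono_mem_Fil {v n : ℤ} {i : ℕ} {j : ℤ} (h1 : v ≤ i + ((q : ℤ) + 1) * j)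
    (h2 : (q : ℤ) * i + (q + 1) * j ≤ n) : mono q F i j ∈ Fil q F v n :=
  Submodule.subset_span ⟨i, j, h1, h2, rfl⟩

lemma Fil_mono {v n n' : ℤ} (h : n ≤ n') : Fil q F v n ≤ Fil q F v n' := by
  apply Submodule.span_mono
  rintro g ⟨i, j, h1, h2, rfl⟩
  exact ⟨i, j, h1, h2.trans h, rfl⟩

lemma Fil_mul (hq : 2 ≤ q) {v n v' n' : ℤ} {g g' : ↥(Dset q F) → F} (hg : g ∈ Fil q F v n)
    (hg' : g' ∈ Fil q F v' n') : g * g' ∈ Fil q F (v + v') (n + n') := by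
  have h := Submodule.mul_mem_mul hg hg'
  unfold Fil at h
  rw [Submodule.span_mul_span] at h
  refine Submodule.span_mono ?_ h
  rintro _ ⟨_, ⟨i, j, h1, h2, rfl⟩, _, ⟨i', j', h1', h2', rfl⟩, rfl⟩
  refine ⟨i + i', j + j', ?_, ?_, mono_mul hq _ _ _ _⟩
  · push_cast; linarith
  · push_cast; linarith

/-- `f` has leading monomial `x^I y^J` and order at least `v` at the origin. -/
def Lead (q : ℕ) (F : Type) [Field F] (v : ℤ) (I : ℕ) (J : ℤ) (f : ↥(Dset q F) → F) : Prop :=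
  v ≤ I + ((q : ℤ) + 1) * J ∧ f - mono q F I J ∈ Fil q F v ((q : ℤ) * I + (q + 1) * J - 1)

lemma Lead_mem {v : ℤ} {I : ℕ} {J : ℤ} {f : ↥(Dset q F) → F} (h : Lead q F v I J f) :
    f ∈ Fil q F v ((q : ℤ) * I + (q + 1) * J) := by
  have := Submodule.add_mem _ (Fil_mono (by linarith) h.2)
    (mono_mem_Fil (F := F) h.1 le_rfl)
  simpa using this

lemma Lead_mul (hq : 2 ≤ q) {v v' : ℤ} {I I' : ℕ} {J J' : ℤ} {f f' : ↥(Dset q F) → F}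
    (h : Lead q F v I J f) (h' : Lead q F v' I' J' f') :
    Lead q F (v + v') (I + I') (J + J') (f * f') := by
  refine ⟨by push_cast; linarith [h.1, h'.1], ?_⟩
  have e : f * f' - mono q F (I + I') (J + J') =
      (f - mono q F I J) * f' + mono q F I J * (f' - mono q F I' J') := by
    rw [← mono_mul hq]; ring
  rw [e]
  refine Submodule.add_mem _ ?_ ?_
  · refine Fil_mono ?_ (Fil_mul hq h.2 (Lead_mem h'))
    push_cast; linarith
  · refine Fil_mono ?_ (Fil_mul hq (mono_mem_Fil h.1 le_rfl) h'.2)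
    push_cast; linarith

/-- upper end of the index interval of the monomials spanning the functions on the support -/
def hiB (q s a₁ b₁ i : ℕ) : ℤ :=
  (s : ℤ) - a₁ - 1 + (if i < a₁ then (q : ℤ) - 1 else 0) + (if i < b₁ - s + a₁ then 1 else 0)
    + (if i < b₁ - s + a₁ - (q + 1) then 1 else 0)
    - (if i = (if a₁ = 0 then q else a₁ - 1) then 1 else 0)

/-- index set of the spanning monomials -/
noncomputable def Bset (q s a₁ b₁ : ℕ) : Finset (Σ _ : ℕ, ℤ) := (Finset.range (q + 1)).sigma fun i =>
    Finset.Icc (if i < b₁ then 1 else 0) (hiB q s a₁ b₁ i)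

lemma sum_ind (n a : ℕ) (z : ℤ) : ∑ i ∈ Finset.range n, (if i < a then z else 0) = min n a * z := by
  induction n with
  | zero => simp
  | succ n ih =>
    rw [Finset.sum_range_succ, ih]
    split_ifs with h
    · rw [min_eq_left (by exact_mod_cast h.le), min_eq_left (by exact_mod_cast h)]
      push_cast; ring
    · rw [min_eq_right (by exact_mod_cast (not_lt.1 h)),
        min_eq_right (by push_cast; have := not_lt.1 h; omega)]
      ring

lemma card_B (hq : 2 ≤ q) (s a₁ b₁ : ℕ) (h1 : a₁ ≤ s) (h2 : s < b₁) (h3 : b₁ ≤ q) (hs : 1 ≤ s) :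
    ((Bset q s a₁ b₁).card : ℤ) = s * q - a₁ - 1 := by
  have : ((Bset q s a₁ b₁).card : ℤ) = ∑ i ∈ Finset.range (q + 1),
      (hiB q s a₁ b₁ i + 1 - (if i < b₁ then 1 else 0)) := by
    simp only [Bset, Finset.card_sigma, Int.card_Icc]
    rw [Nat.cast_sum]
    refine Finset.sum_congr rfl fun i hi => ?_
    rw [Finset.mem_range] at hi
    refine Int.toNat_of_nonneg ?_
    unfold hiB
    split_ifs <;> omega
  rw [this]
  simp only [hiB, Finset.sum_sub_distrib, Finset.sum_add_distrib, sum_ind, Finset.sum_ite_eq',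
    Finset.sum_const, Finset.card_range, nsmul_eq_mul]
  rw [if_pos (by rw [Finset.mem_range]; split_ifs <;> omega)]
  have e1 : min (q + 1) a₁ = a₁ := by omega
  have e2 : min (q + 1) b₁ = b₁ := by omega
  have e3 : ((min (q + 1) (b₁ - s + a₁) : ℕ) : ℤ) +
    ((min (q + 1) (b₁ - s + a₁ - (q + 1)) : ℕ) : ℤ) = (b₁ : ℤ) - s + a₁ := by omega
  rw [e1, e2]
  rw [show ((q + 1 : ℕ) : ℤ) = (q : ℤ) + 1 by push_cast; ring]
  linear_combination e3

lemma exists_orth (A : Finset ↥(Dset q F)) {ι : Type} (B : Finset ι)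
    (h : B.card < A.card) (g : ι → ↥(Dset q F) → F) :
    ∃ c : ↥(Dset q F) → F, c ≠ 0 ∧ (∀ P, P ∉ A → c P = 0) ∧ ∀ p ∈ B, ∑ P, c P * g p P = 0 := by
  classical
  let Φ : (A → F) →ₗ[F] (B → F) :=
    { toFun := fun c p => ∑ P : A, c P * g p P
      map_add' := by
        intro c c'; funext p
        simp [add_mul, Finset.sum_add_distrib]
      map_smul' := by
        intro r c; funext p
        simp [mul_assoc, Finset.mul_sum] }
  have hk : LinearMap.ker Φ ≠ ⊥ := by
    apply LinearMap.ker_ne_bot_of_finrank_lt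
    simpa [Module.finrank_fintype_fun_eq_card] using h
  obtain ⟨c, hc, hne⟩ := (Submodule.ne_bot_iff _).1 hk
  refine ⟨fun P => if hP : P ∈ A then c ⟨P, hP⟩ else 0, ?_, ?_, ?_⟩
  · intro h0
    apply hne
    funext P
    have := congrFun h0 P
    simpa using this
  · intro P hP
    simp [hP]
  · intro p hp
    have := congrFun (LinearMap.mem_ker.1 hc) ⟨p, hp⟩
    simp only [Φ, LinearMap.coe_mk, AddHom.coe_mk, Pi.zero_apply] at this
    refine Eq.trans ?_ this
    rw [← Finset.sum_subset (Finset.subset_univ A)]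
    · rw [← Finset.sum_coe_sort]
      refine Finset.sum_congr rfl fun P _ => ?_
      simp
    · intro P _ hP
      simp [hP]

lemma upper_aux (hq : 2 ≤ q) (s a₁ b₁ : ℕ) (h1 : a₁ ≤ s) (h2 : s < b₁) (h3 : b₁ ≤ q)
    (c : ↥(Dset q F) → F) (f : ↥(Dset q F) → F)
    (hf : Lead q F s a₁ ((s : ℤ) - a₁) f) (hcf : ∀ P, c P * f P = 0)
    (hB : ∀ p ∈ Bset q s a₁ b₁, pair c p.1 p.2 = 0) :
    ∀ n : ℕ, (n : ℤ) ≤ ((q : ℤ) - 2 + s) * (q + 1) - a₁ → ∀ i : ℕ, ∀ j : ℤ,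
      (q : ℤ) * i + (q + 1) * j = n →
      b₁ ≤ i + ((q : ℤ) + 1) * j → pair c i j = 0 := by
  have hq' : (2 : ℤ) ≤ q := by exact_mod_cast hq
  have h1' : (a₁ : ℤ) ≤ s := by exact_mod_cast h1
  have h2' : (s : ℤ) < b₁ := by exact_mod_cast h2
  have h3' : (b₁ : ℤ) ≤ q := by exact_mod_cast h3
  intro n
  induction n using Nat.strong_induction_on with
  | _ n ihn =>
  intro hn
  -- lower order terms
  have hlow : ∀ i : ℕ, ∀ j : ℤ, (q : ℤ) * i + (q + 1) * j < n →
      b₁ ≤ i + ((q : ℤ) + 1) * j → pair c i j = 0 := by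
    intro i j hlt hv
    have hnn : 0 ≤ (q : ℤ) * i + (q + 1) * j := by
      have : (0 : ℤ) ≤ i := by positivity
      nlinarith
    obtain ⟨m, hm⟩ := Int.eq_ofNat_of_zero_le hnn
    exact ihn m (by omega) (by omega) i j hm hv
  have hFil : ∀ g ∈ Fil q F b₁ (n - 1), ∑ P, c P * g P = 0 := by
    intro g hg
    unfold Fil at hg
    induction hg using Submodule.span_induction with
    | mem g hg =>
      obtain ⟨i, j, e1, e2, rfl⟩ := hg
      exact hlow i j (by linarith) e1
    | zero => simp
    | add g g' _ _ e e' => simp [mul_add, Finset.sum_add_distrib, e, e']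
    | smul r g _ e =>
      simp only [Pi.smul_apply, smul_eq_mul, mul_left_comm _ r, ← Finset.mul_sum, e, mul_zero]
  -- multiples of f
  have hmult : ∀ i' : ℕ, ∀ j' : ℤ, (q : ℤ) * (a₁ + i' : ℕ) + (q + 1) * (s - a₁ + j') = n →
      (b₁ : ℤ) - s ≤ i' + ((q : ℤ) + 1) * j' → pair c (a₁ + i') (s - a₁ + j') = 0 := by
    intro i' j' e1 e2
    have e3 : (f - mono q F a₁ (s - a₁)) * mono q F i' j' ∈ Fil q F b₁ (n - 1) := by
      have := Fil_mul hq hf.2 (mono_mem_Fil e2 le_rfl)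
      rw [add_sub_cancel] at this
      refine Fil_mono ?_ this
      push_cast at e1
      linarith
    have e4 := hFil _ e3
    rw [sub_mul, mono_mul hq] at e4
    simp only [Pi.sub_apply, Pi.mul_apply, mul_sub, ← mul_assoc, hcf,
      zero_mul, zero_sub, Finset.sum_neg_distrib, neg_eq_zero] at e4
    exact e4
  intro i
  induction i using Nat.strong_induction_on with
  | _ i ihi =>
  intro j hj hv
  by_cases hi : i ≤ q
  · have hi' : (i : ℤ) ≤ q := by exact_mod_cast hi
    have hj0 : 0 ≤ j := by
      by_contra! h
      nlinarith
    have hjl : (if i < b₁ then (1 : ℤ) else 0) ≤ j := by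
      split_ifs with h
      · by_contra! h'
        have : j = 0 := by omega
        subst this
        simp at hv
        omega
      · exact hj0
    by_cases hjB : j ≤ hiB q s a₁ b₁ i
    · refine hB ⟨i, j⟩ ?_
      simp only [Bset, Finset.mem_sigma, Finset.mem_range, Finset.mem_Icc]
      exact ⟨by omega, hjl, hjB⟩
    · push Not at hjB
      by_cases hia : a₁ ≤ i
      · have hia' : (a₁ : ℤ) ≤ i := by exact_mod_cast hia
        have hex : ¬ (i = a₁ + q ∧ j = s - a₁ - 1) := by
          rintro ⟨rfl, rfl⟩
          push_cast at hj
          nlinarith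
        have hv' : (b₁ : ℤ) - s ≤ ((i - a₁ : ℕ) : ℤ) + ((q : ℤ) + 1) * (j - (s - a₁)) := by
          rw [Nat.cast_sub hia]
          have hjj : (if i < b₁ - s + a₁ then (1 : ℤ) else 0) ≤ j - (s - a₁) := by
            unfold hiB at hjB
            split_ifs at hjB ⊢ <;> omega
          split_ifs at hjj with h
          · nlinarith
          · have : (b₁ : ℤ) - s + a₁ ≤ i := by omega
            nlinarith
        have e := hmult (i - a₁) (j - (s - a₁)) (by
          rw [show a₁ + (i - a₁) = i by omega]; linarith) hv'
        rw [show a₁ + (i - a₁) = i by omega,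
          show (s : ℤ) - a₁ + (j - (s - a₁)) = j by ring] at e
        exact e
      · push Not at hia
        have hia' : (i : ℤ) < a₁ := by exact_mod_cast hia
        have hex : ¬ (i + 1 = a₁ ∧ j = s - a₁ + q - 1) := by
          rintro ⟨e, rfl⟩
          have : (a₁ : ℤ) = i + 1 := by exact_mod_cast e.symm
          rw [this] at hj hn
          nlinarith
        have hjj : (if i < b₁ - s + a₁ - (q + 1) then (1 : ℤ) else 0) ≤ j - q - (s - a₁) := by
          unfold hiB at hjB
          split_ifs at hjB ⊢ <;> omega
        have hle : a₁ ≤ i + (q + 1) := by omega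
        have hv' : (b₁ : ℤ) - s ≤ ((i + (q + 1) - a₁ : ℕ) : ℤ) +
            ((q : ℤ) + 1) * (j - q - (s - a₁)) := by
          rw [Nat.cast_sub hle]
          push_cast
          split_ifs at hjj with h
          · nlinarith
          · have : (b₁ : ℤ) - s + a₁ ≤ i + q + 1 := by omega
            nlinarith
        have e := hmult (i + (q + 1) - a₁) (j - q - (s - a₁)) (by
          rw [show a₁ + (i + (q + 1) - a₁) = i + (q + 1) by omega]
          push_cast; linarith) hv'
        rw [show a₁ + (i + (q + 1) - a₁) = i + (q + 1) by omega,
          show (s : ℤ) - a₁ + (j - q - (s - a₁)) = j - q by ring, pair_red hq,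
          sub_add_cancel] at e
        have hj2 : 0 ≤ j - q := by
          split_ifs at hjj <;> linarith
        rw [hlow i (j - q + 1) (by nlinarith) (by nlinarith), add_zero] at e
        exact e
  · obtain ⟨k, rfl⟩ : ∃ k, i = k + (q + 1) := ⟨i - (q + 1), by omega⟩
    push_cast at hj hv
    rw [pair_red hq, ihi k (by omega) (j + q) (by linarith) (by nlinarith),
      hlow k (j + 1) (by nlinarith) (by nlinarith), add_zero]

lemma upper (hq : 2 ≤ q) (s a₁ b₁ : ℕ) (h1 : a₁ ≤ s) (h2 : s < b₁) (h3 : b₁ ≤ q) (hs : 1 ≤ s)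
    (A : Finset ↥(Dset q F)) (hA : s * q - a₁ ≤ A.card) (f : ↥(Dset q F) → F)
    (hf : Lead q F s a₁ ((s : ℤ) - a₁) f) (hfA : ∀ P ∈ A, f P = 0) :
    ∃ c : ↥(Dset q F) → F, c ≠ 0 ∧ wt c ≤ s * q - a₁ ∧ ∀ i : ℕ, ∀ j : ℤ,
      (q : ℤ) * i + (q + 1) * j ≤ ((q : ℤ) - 2 + s) * (q + 1) - a₁ →
      b₁ ≤ i + ((q : ℤ) + 1) * j → pair c i j = 0 := by
  classical
  obtain ⟨A', hA', hcard⟩ := Finset.exists_subset_card_eq hA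
  have hB := card_B hq s a₁ b₁ h1 h2 h3 hs
  have haq : a₁ ≤ s * q := by nlinarith
  have hlt : (Bset q s a₁ b₁).card < A'.card := by
    rw [hcard]; zify [haq]; omega
  obtain ⟨c, hc, hc0, hcB⟩ := exists_orth A' (Bset q s a₁ b₁) hlt (fun p => mono q F p.1 p.2)
  refine ⟨c, hc, ?_, ?_⟩
  · rw [← hcard, wt, Nat.card_eq_fintype_card, Fintype.card_subtype]
    apply Finset.card_le_card
    intro P hP
    by_contra hn
    simp [hc0 P hn] at hP
  · intro i j e1 e2
    have hnn : 0 ≤ (q : ℤ) * i + (q + 1) * j := by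
      have : (0 : ℤ) ≤ i := by positivity
      have : (2 : ℤ) ≤ q := by exact_mod_cast hq
      nlinarith
    obtain ⟨m, hm⟩ := Int.eq_ofNat_of_zero_le hnn
    refine upper_aux hq s a₁ b₁ h1 h2 h3 c f hf ?_ hcB m (by rw [hm] at e1; exact e1) i j hm e2
    intro P
    by_cases hP : P ∈ A'
    · rw [hfA P (hA' hP), mul_zero]
    · rw [hc0 P hP, zero_mul]

lemma Lead_mono (i : ℕ) (j v : ℤ) (h : v ≤ i + ((q : ℤ) + 1) * j) :
    Lead q F v i j (mono q F i j) := ⟨h, by rw [sub_self]; exact Submodule.zero_mem _⟩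

lemma Lead_prod (hq : 2 ≤ q) {ι : Type} (T : Finset ι) (v : ℤ) (I : ℕ) (J : ℤ)
    (f : ι → ↥(Dset q F) → F) (h : ∀ t ∈ T, Lead q F v I J (f t)) :
    Lead q F (T.card * v) (T.card * I) (T.card * J) (∏ t ∈ T, f t) := by
  classical
  induction T using Finset.induction_on with
  | empty =>
    have : (1 : ↥(Dset q F) → F) = mono q F 0 0 := by funext P; simp [mono]
    simp only [Finset.card_empty, Finset.prod_empty, Nat.cast_zero, zero_mul, this]
    exact Lead_mono _ _ _ (by simp)
  | insert t T ht ih =>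
    rw [Finset.prod_insert ht, Finset.card_insert_of_notMem ht]
    have := Lead_mul hq (h t (Finset.mem_insert_self _ _))
      (ih fun t' ht' => h t' (Finset.mem_insert_of_mem ht'))
    convert this using 1
    · push_cast; ring
    · ring
    · push_cast; ring

lemma Lead_conic (hq : 2 ≤ q) (r : F) :
    Lead q F 2 2 0 (fun P => (P : F × F).1 ^ 2 - r * (P : F × F).2) := by
  have hq' : (2 : ℤ) ≤ q := by exact_mod_cast hq
  refine ⟨by simp, ?_⟩
  have : (fun P : ↥(Dset q F) => (P : F × F).1 ^ 2 - r * (P : F × F).2) - mono q F 2 0 =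
      (-r) • mono q F 0 1 := by
    funext P; simp [mono]
  rw [this]
  refine Submodule.smul_mem _ _ (mono_mem_Fil ?_ ?_) <;> push_cast <;> linarith

lemma Lead_line (hq : 2 ≤ q) (r : F) :
    Lead q F 1 0 1 (fun P => (P : F × F).2 - r * (P : F × F).1) := by
  have hq' : (2 : ℤ) ≤ q := by exact_mod_cast hq
  refine ⟨by push_cast; linarith, ?_⟩
  have : (fun P : ↥(Dset q F) => (P : F × F).2 - r * (P : F × F).1) - mono q F 0 1 =
      (-r) • mono q F 1 0 := by
    funext P; simp [mono]
  rw [this]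
  refine Submodule.smul_mem _ _ (mono_mem_Fil ?_ ?_) <;> push_cast <;> linarith

lemma add_q (hpp : IsPrimePow q) (hF : Fintype.card F = q ^ 2) (x y : F) :
    (x + y) ^ q = x ^ q + y ^ q := by
  obtain ⟨p, k, hp, hk, rfl⟩ := hpp
  have : Fact p.Prime := ⟨hp.nat_prime⟩
  have : CharP F p := charP_of_card_eq_prime_pow (f := k * 2) (by rw [hF, pow_mul])
  exact add_pow_char_pow x y p k

lemma pow_qq (hF : Fintype.card F = q ^ 2) (x : F) : (x ^ q) ^ q = x := by
  rw [← pow_mul, ← sq, ← hF, FiniteField.pow_card]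

open Classical in
lemma card_le_q (hq : 2 ≤ q) (r e : F) :
    (Finset.univ.filter fun v : F => v ^ q + r * v = e).card ≤ q := by
  have hdeg : (Polynomial.X ^ q + (Polynomial.C r * Polynomial.X - Polynomial.C e) :
      Polynomial F).natDegree = q := by
    rw [Polynomial.natDegree_add_eq_left_of_natDegree_lt, Polynomial.natDegree_X_pow]
    rw [Polynomial.natDegree_X_pow]
    refine lt_of_le_of_lt ?_ hq
    compute_degree
  have hne : (Polynomial.X ^ q + (Polynomial.C r * Polynomial.X - Polynomial.C e) :
      Polynomial F) ≠ 0 := by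
    intro h
    rw [h] at hdeg
    simp at hdeg
    omega
  calc _ ≤ (Polynomial.X ^ q + (Polynomial.C r * Polynomial.X - Polynomial.C e) :
      Polynomial F).roots.toFinset.card := by
        apply Finset.card_le_card
        intro v hv
        simp only [Finset.mem_filter, Finset.mem_univ, true_and] at hv
        rw [Multiset.mem_toFinset, Polynomial.mem_roots hne]
        simp only [Polynomial.IsRoot.def, Polynomial.eval_add, Polynomial.eval_pow,
          Polynomial.eval_X, Polynomial.eval_sub, Polynomial.eval_mul, Polynomial.eval_C]
        rw [← add_sub_assoc, hv, sub_self]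
    _ ≤ _ := (Multiset.toFinset_card_le _).trans ((Polynomial.card_roots' _).trans hdeg.le)

open Classical in
lemma card_facts (hq : 2 ≤ q) (hpp : IsPrimePow q) (hF : Fintype.card F = q ^ 2) :
    (Finset.univ.filter fun v : F => v ^ q = v).card = q ∧
    ∀ e : F, e ^ q = e → (Finset.univ.filter fun v : F => v ^ q + v = e).card = q := by
  set Fx := Finset.univ.filter fun v : F => v ^ q = v with hFx
  have h1 : Fx.card ≤ q := by
    have := card_le_q hq (-1 : F) 0
    refine le_trans (Finset.card_le_card ?_) this
    intro v hv
    simp only [hFx, Finset.mem_filter, Finset.mem_univ, true_and] at hv ⊢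
    rw [hv]; ring
  have h2 : ∀ e : F, (Finset.univ.filter fun v : F => v ^ q + v = e).card ≤ q := by
    intro e
    have := card_le_q hq (1 : F) e
    simpa only [one_mul] using this
  have h3 : q ^ 2 = ∑ e ∈ Fx, (Finset.univ.filter fun v : F => v ^ q + v = e).card := by
    rw [← hF, ← Finset.card_univ]
    apply Finset.card_eq_sum_card_fiberwise
    intro v _
    simp only [hFx, Finset.coe_filter, Finset.mem_univ, true_and, Set.mem_ofPred_eq]
    rw [add_q hpp hF, pow_qq hF, add_comm]
  have h4 : Fx.card = q := by
    apply le_antisymm h1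
    have : q ^ 2 ≤ Fx.card * q := by
      rw [h3, ← smul_eq_mul]
      exact Finset.sum_le_card_nsmul _ _ _ fun e _ => h2 e
    nlinarith
  refine ⟨h4, ?_⟩
  intro e he
  by_contra hne
  have hlt : ∑ e ∈ Fx, (Finset.univ.filter fun v : F => v ^ q + v = e).card < ∑ e ∈ Fx, q :=
    Finset.sum_lt_sum (fun e _ => h2 e) ⟨e, by simp [hFx, he], lt_of_le_of_ne (h2 e) hne⟩
  rw [← h3, Finset.sum_const, h4, smul_eq_mul, sq] at hlt
  exact lt_irrefl _ hlt

lemma construct (hq : 2 ≤ q) (hpp : IsPrimePow q) (hF : Fintype.card F = q ^ 2)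
    (s a₁ : ℕ) (h1 : a₁ ≤ s) (h2 : s < q) :
    ∃ (A : Finset ↥(Dset q F)) (f : ↥(Dset q F) → F), s * q - a₁ ≤ A.card ∧
      Lead q F s a₁ ((s : ℤ) - a₁) f ∧ ∀ P ∈ A, f P = 0 := by
  classical
  obtain ⟨hFx, hTr⟩ := card_facts hq hpp hF
  have hq0 : q ≠ 0 := by omega
  -- the nonzero elements of the small field
  set K := (Finset.univ.filter fun v : F => v ^ q = v).erase 0 with hK
  have hKc : K.card = q - 1 := by
    rw [hK, Finset.card_erase_of_mem (by simp [hq0]), hFx]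
  have hKm : ∀ k, k ∈ K ↔ k ≠ 0 ∧ k ^ q = k := by intro k; simp [hK]
  set N := Finset.univ.filter fun v : F => v ^ q + v = 1 with hN
  have hNc : N.card = q := hTr 1 (one_pow _)
  have hNm : ∀ m, m ∈ N ↔ m ^ q + m = 1 := by intro m; simp [hN]
  have hN0 : ∀ m ∈ N, m ≠ 0 := by
    rintro m hm rfl
    rw [hNm] at hm
    simp [hq0] at hm
  have hNq : ∀ m ∈ N, m ^ q ∈ N := by
    intro m hm
    rw [hNm] at hm ⊢
    rw [pow_qq hF, add_comm]; exact hm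
  -- an element outside the small field
  obtain ⟨g, hg⟩ : ∃ g : F, g ^ q ≠ g := by
    by_contra! h
    have : (Finset.univ.filter fun v : F => v ^ q = v) = Finset.univ := by
      ext v; simp [h v]
    rw [this, Finset.card_univ, hF] at hFx
    nlinarith
  have hg0 : g ≠ 0 := by rintro rfl; simp [hq0] at hg
  obtain ⟨Ts, hTs, hTsc⟩ := Finset.exists_subset_card_eq (s := K) (n := s - a₁) (by omega)
  -- the good trace one elements
  obtain ⟨Ms, hMs, hMsc⟩ : ∃ Ms : Finset F, (∀ m ∈ Ms, m ∈ N ∧ m ^ q ≠ m ∧ (g * m) ^ q ≠ g * m) ∧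
      Ms.card = a₁ / 2 := by
    have hb1 : (N.filter fun m => m ^ q = m).card ≤ 1 := by
      rw [Finset.card_le_one]
      intro m hm m' hm'
      simp only [Finset.mem_filter, hNm] at hm hm'
      have e1 : 2 * m = 1 := by linear_combination hm.1 - hm.2
      have e2 : 2 * m' = 1 := by linear_combination hm'.1 - hm'.2
      have e3 : (2 : F) ≠ 0 := by intro h; rw [h, zero_mul] at e1; exact zero_ne_one e1
      exact mul_left_cancel₀ e3 (e1.trans e2.symm)
    have hb2 : (N.filter fun m => (g * m) ^ q = g * m).card ≤ 1 := by
      rw [Finset.card_le_one]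
      intro m hm m' hm'
      simp only [Finset.mem_filter, hNm, mul_pow] at hm hm'
      have e1 : (g + g ^ q) * m = g ^ q := by linear_combination g ^ q * hm.1 - hm.2
      have e2 : (g + g ^ q) * m' = g ^ q := by linear_combination g ^ q * hm'.1 - hm'.2
      have e3 : (g + g ^ q) ≠ 0 := by
        intro h; rw [h, zero_mul] at e1; exact pow_ne_zero q hg0 e1.symm
      exact mul_left_cancel₀ e3 (e1.trans e2.symm)
    have hc : a₁ / 2 ≤ (N \ ((N.filter fun m => m ^ q = m) ∪
        (N.filter fun m => (g * m) ^ q = g * m))).card := by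
      have e1 := Finset.le_card_sdiff ((N.filter fun m => m ^ q = m) ∪
        (N.filter fun m => (g * m) ^ q = g * m)) N
      have e2 := Finset.card_union_le (N.filter fun m => m ^ q = m)
        (N.filter fun m => (g * m) ^ q = g * m)
      omega
    obtain ⟨Ms, hsub, hcard⟩ := Finset.exists_subset_card_eq hc
    refine ⟨Ms, ?_, hcard⟩
    intro m hm
    have := hsub hm
    simp only [Finset.mem_sdiff, Finset.mem_union, Finset.mem_filter, not_or, not_and] at this
    exact ⟨this.1, this.2.1 this.1, this.2.2 this.1⟩
  -- the parametrisation of the points off the line x = 0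
  let Ψ : F × F → F × F := fun z => (z.2 ^ q / z.1, z.2 ^ (q + 1) / z.1)
  let I₁ := N ×ˢ Ts
  let I₂ := (Ms ×ˢ K).image fun z : F × F => (z.1, g * z.2)
  let I₃ := (Ms ×ˢ K).image fun z : F × F => (z.1 ^ q, g * z.1 * z.2)
  have hI₁ : ∀ z ∈ I₁, z.1 ∈ N ∧ z.2 ≠ 0 := by
    intro z hz
    rw [Finset.mem_product] at hz
    exact ⟨hz.1, ((hKm _).1 (hTs hz.2)).1⟩
  have hI₂ : ∀ z ∈ I₂, z.1 ∈ N ∧ z.2 ≠ 0 := by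
    intro z hz
    obtain ⟨⟨m, k⟩, hmk, rfl⟩ := Finset.mem_image.1 hz
    rw [Finset.mem_product] at hmk
    exact ⟨(hMs _ hmk.1).1, mul_ne_zero hg0 ((hKm _).1 hmk.2).1⟩
  have hI₃ : ∀ z ∈ I₃, z.1 ∈ N ∧ z.2 ≠ 0 := by
    intro z hz
    obtain ⟨⟨m, k⟩, hmk, rfl⟩ := Finset.mem_image.1 hz
    rw [Finset.mem_product] at hmk
    exact ⟨hNq _ (hMs _ hmk.1).1,
      mul_ne_zero (mul_ne_zero hg0 (hN0 _ (hMs _ hmk.1).1)) ((hKm _).1 hmk.2).1⟩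
  have hI : ∀ z ∈ I₁ ∪ I₂ ∪ I₃, z.1 ∈ N ∧ z.2 ≠ 0 := by
    intro z hz
    simp only [Finset.mem_union] at hz
    rcases hz with (hz | hz) | hz
    · exact hI₁ z hz
    · exact hI₂ z hz
    · exact hI₃ z hz
  have hd12 : Disjoint I₁ I₂ := by
    rw [Finset.disjoint_left]
    intro z hz hz'
    obtain ⟨⟨m, k⟩, hmk, rfl⟩ := Finset.mem_image.1 hz'
    rw [Finset.mem_product] at hz hmk
    have e1 := ((hKm _).1 (hTs hz.2)).2
    have e2 := (hKm _).1 hmk.2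
    simp only at e1 e2
    rw [mul_pow, e2.2] at e1
    exact hg (mul_right_cancel₀ e2.1 e1)
  have hd3 : Disjoint (I₁ ∪ I₂) I₃ := by
    rw [Finset.disjoint_left]
    intro z hz hz'
    obtain ⟨⟨m, k⟩, hmk, rfl⟩ := Finset.mem_image.1 hz'
    rw [Finset.mem_product] at hmk
    have e2 := (hKm _).1 hmk.2
    have e3 := hMs _ hmk.1
    simp only at e2 e3
    rcases Finset.mem_union.1 hz with hz | hz
    · rw [Finset.mem_product] at hz
      have e1 := ((hKm _).1 (hTs hz.2)).2
      simp only at e1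
      rw [mul_pow, e2.2] at e1
      exact e3.2.2 (mul_right_cancel₀ e2.1 e1)
    · obtain ⟨⟨m', k'⟩, hmk', he⟩ := Finset.mem_image.1 hz
      rw [Finset.mem_product] at hmk'
      have e4 := (hKm _).1 hmk'.2
      simp only [Prod.mk.injEq] at he e4
      have e5 : k' = m * k := mul_left_cancel₀ hg0 (by rw [he.2]; ring)
      have e6 := e4.2
      rw [e5, mul_pow, e2.2] at e6
      exact e3.2.1 (mul_right_cancel₀ e2.1 e6)
  have hc2 : I₂.card = a₁ / 2 * (q - 1) := by
    rw [Finset.card_image_of_injective, Finset.card_product, hMsc, hKc]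
    rintro ⟨m, k⟩ ⟨m', k'⟩ h
    simp only [Prod.mk.injEq] at h ⊢
    exact ⟨h.1, mul_left_cancel₀ hg0 h.2⟩
  have hc3 : I₃.card = a₁ / 2 * (q - 1) := by
    rw [Finset.card_image_of_injOn, Finset.card_product, hMsc, hKc]
    rintro ⟨m, k⟩ hm ⟨m', k'⟩ hm' h
    simp only [Prod.mk.injEq] at h ⊢
    have e : m = m' := by rw [← pow_qq hF m, h.1, pow_qq hF]
    subst e
    rw [Finset.mem_coe, Finset.mem_product] at hm
    exact ⟨rfl, mul_left_cancel₀ (mul_ne_zero hg0 (hN0 _ (hMs _ hm.1).1)) h.2⟩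
  have hcI : (I₁ ∪ I₂ ∪ I₃).card = q * (s - a₁) + a₁ / 2 * (q - 1) + a₁ / 2 * (q - 1) := by
    rw [Finset.card_union_of_disjoint hd3, Finset.card_union_of_disjoint hd12, hc2, hc3,
      Finset.card_product, hNc, hTsc]
  have hΨ : Set.InjOn Ψ ((I₁ ∪ I₂ ∪ I₃ : Finset (F × F)) : Set (F × F)) := by
    rintro ⟨m, w⟩ hz ⟨m', w'⟩ hz' h
    obtain ⟨e1, e2⟩ := hI _ hz
    obtain ⟨e1', e2'⟩ := hI _ hz'
    have e3 := hN0 _ e1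
    have e3' := hN0 _ e1'
    simp only [Ψ, Prod.mk.injEq] at h e1 e2 e1' e2' e3 e3'
    obtain ⟨h1, h2⟩ := h
    rw [pow_succ, pow_succ, mul_div_right_comm, mul_div_right_comm, h1] at h2
    have e4 : w = w' := mul_left_cancel₀ (div_ne_zero (pow_ne_zero _ e2') e3') h2
    subst e4
    rw [div_eq_div_iff e3 e3'] at h1
    rw [mul_left_cancel₀ (pow_ne_zero _ e2) h1]
  have hΨD : ∀ z : F × F, z.1 ∈ N → z.2 ≠ 0 → Ψ z ∈ Dset q F := by
    rintro ⟨m, w⟩ hm hw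
    have e3 := hN0 _ hm
    rw [hNm] at hm
    simp only [Ψ] at hm hw e3 ⊢
    refine ⟨?_, ?_⟩
    · simp only
      rw [div_pow, div_pow, pow_succ w q, mul_pow, pow_succ (w ^ q) q, pow_qq hF, pow_succ m q]
      have e4 := pow_ne_zero q e3
      generalize m ^ q = n at *
      generalize w ^ q = v at *
      field_simp
      linear_combination v * hm
    · intro h
      have := congrArg Prod.fst h
      simp only [Prod.fst_zero, div_eq_zero_iff] at this
      rcases this with h | h
      · exact pow_ne_zero _ hw h
      · exact e3 h
  -- the points on the line x = 0
  let E₀ : Finset (F × F) := if a₁ % 2 = 1 then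
    ((Finset.univ.filter fun v : F => v ^ q + v = 0).erase 0).image fun v => ((0 : F), v) else ∅
  have hE₀c : E₀.card = a₁ % 2 * (q - 1) := by
    simp only [E₀]
    split_ifs with h
    · rw [Finset.card_image_of_injective, Finset.card_erase_of_mem (by simp [hq0]),
        hTr 0 (by simp [hq0]), h, one_mul]
      intro v v' h
      exact (Prod.mk.inj h).2
    · have : a₁ % 2 = 0 := by omega
      simp [this]
  have hE₀m : ∀ z ∈ E₀, a₁ % 2 = 1 ∧ z.1 = 0 ∧ z ∈ Dset q F := by
    intro z hz
    simp only [E₀] at hz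
    split_ifs at hz with h
    · obtain ⟨v, hv, rfl⟩ := Finset.mem_image.1 hz
      simp only [Finset.mem_erase, Finset.mem_filter, Finset.mem_univ, true_and] at hv
      refine ⟨h, rfl, ?_, ?_⟩
      · simp only; rw [hv.2]; simp
      · intro h'
        exact hv.1 (congrArg Prod.snd h')
    · simp at hz
  let E : Finset (F × F) := E₀ ∪ (I₁ ∪ I₂ ∪ I₃).image Ψ
  have hEc : E.card = a₁ % 2 * (q - 1) + (q * (s - a₁) + a₁ / 2 * (q - 1) + a₁ / 2 * (q - 1)) := by
    rw [Finset.card_union_of_disjoint, hE₀c, Finset.card_image_of_injOn hΨ, hcI]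
    rw [Finset.disjoint_left]
    intro z hz hz'
    obtain ⟨z', hz'', rfl⟩ := Finset.mem_image.1 hz'
    have e1 := (hE₀m _ hz).2.1
    obtain ⟨e2, e3⟩ := hI _ hz''
    exact div_ne_zero (pow_ne_zero _ e3) (hN0 _ e2) e1
  have hED : ∀ z ∈ E, z ∈ Dset q F := by
    intro z hz
    rcases Finset.mem_union.1 hz with hz | hz
    · exact (hE₀m z hz).2.2
    · obtain ⟨z', hz', rfl⟩ := Finset.mem_image.1 hz
      exact hΨD _ (hI _ hz').1 (hI _ hz').2
  let f : ↥(Dset q F) → F := mono q F (a₁ % 2) 0 *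
    (∏ m ∈ Ms, fun P : ↥(Dset q F) => (P : F × F).1 ^ 2 - (g ^ q / (g * m)) * (P : F × F).2) *
    (∏ t ∈ Ts, fun P : ↥(Dset q F) => (P : F × F).2 - t * (P : F × F).1)
  refine ⟨E.subtype (· ∈ Dset q F), f, ?_, ?_, ?_⟩
  · rw [Finset.card_subtype, Finset.filter_true_of_mem hED, hEc]
    have e1 : a₁ = 2 * (a₁ / 2) + a₁ % 2 := by omega
    obtain ⟨r, hr⟩ : ∃ r, q = r + 1 := ⟨q - 1, by omega⟩
    obtain ⟨u, hu⟩ : ∃ u, s = a₁ + u := ⟨s - a₁, by omega⟩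
    rw [hu, hr, Nat.add_sub_cancel_left, Nat.add_sub_cancel]
    generalize a₁ / 2 = k at *
    generalize a₁ % 2 = ε at *
    rw [e1, Nat.sub_le_iff_le_add]
    apply le_of_eq
    ring
  · have e1 := Lead_mul hq (Lead_mul hq (Lead_mono (q := q) (F := F) (a₁ % 2) 0
      ((a₁ % 2 : ℕ) : ℤ) (by simp))
      (Lead_prod hq Ms 2 2 0 _ fun m _ => Lead_conic hq (g ^ q / (g * m))))
      (Lead_prod hq Ts 1 0 1 _ fun t _ => Lead_line hq t)
    rw [hMsc, hTsc] at e1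
    convert e1 using 1
    · omega
    · omega
    · rw [Nat.cast_sub h1]; ring
  · intro P hP
    rw [Finset.mem_subtype] at hP
    simp only [f, Pi.mul_apply, Finset.prod_apply, mul_eq_zero, Finset.prod_eq_zero_iff]
    rcases Finset.mem_union.1 hP with hP | hP
    · left; left
      obtain ⟨e1, e2, -⟩ := hE₀m _ hP
      simp [mono, e1, e2]
    · obtain ⟨z, hz, hzP⟩ := Finset.mem_image.1 hP
      have hz1 := hI z hz
      rw [← hzP]
      simp only [Finset.mem_union] at hz
      rcases hz with (hz | hz) | hz
      · right
        rw [Finset.mem_product] at hz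
        refine ⟨z.2, hz.2, ?_⟩
        simp only [Ψ]
        ring
      · left; right
        obtain ⟨⟨m, k⟩, hmk, rfl⟩ := Finset.mem_image.1 hz
        rw [Finset.mem_product] at hmk
        refine ⟨m, hmk.1, ?_⟩
        have e0 := hN0 _ (hMs _ hmk.1).1
        have e2 := ((hKm _).1 hmk.2).2
        simp only [Ψ] at e0 e2 ⊢
        rw [pow_succ (g * k) q, mul_pow g k q, e2]
        field_simp
        ring
      · left; right
        obtain ⟨⟨m, k⟩, hmk, rfl⟩ := Finset.mem_image.1 hz
        rw [Finset.mem_product] at hmk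
        refine ⟨m, hmk.1, ?_⟩
        have e0 := hN0 _ (hMs _ hmk.1).1
        have e2 := ((hKm _).1 hmk.2).2
        simp only [Ψ] at e0 e2 ⊢
        have e4 := pow_ne_zero q e0
        rw [pow_succ (g * m * k) q, mul_pow (g * m) k q, mul_pow g m q, e2]
        field_simp
        ring

lemma mem_dual (c : ↥(Dset q F) → F) (m n : ℤ) : c ∈ dualCode q F m n ↔
    ∀ i : ℕ, i ≤ q → ∀ j : ℤ, (q : ℤ) * i + (q + 1) * j ≤ m → -n ≤ i + ((q : ℤ) + 1) * j →
      pair c i j = 0 := by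
  constructor
  · intro h i hi j h1 h2
    have := h (evalVec q F ((i : ℤ), j)) (Submodule.subset_span
      ⟨_, ⟨by simp, Int.ofNat_le.2 hi, h1, h2⟩, rfl⟩)
    simpa only [evalVec, zpow_natCast, pair, mono] using this
  · intro h w hw
    unfold Code at hw
    induction hw using Submodule.span_induction with
    | mem w hw =>
      obtain ⟨⟨i, j⟩, ⟨h0, h1, h2, h3⟩, rfl⟩ := hw
      simp only at h0 h1 h2 h3
      lift i to ℕ using h0
      have := h i (by exact_mod_cast h1) j h2 h3
      simpa only [evalVec, zpow_natCast, pair, mono] using this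
    | zero => simp
    | add x y _ _ hx hy => simp only [Pi.add_apply, mul_add, Finset.sum_add_distrib, hx, hy, add_zero]
    | smul r x _ hx =>
      simp only [Pi.smul_apply, smul_eq_mul, mul_left_comm _ r, ← Finset.mul_sum, hx, mul_zero]

/-- multiplication of a word by a power of `y`. -/
def twist (e : ℤ) (c : ↥(Dset q F) → F) : ↥(Dset q F) → F :=
  fun P => c P * (P : F × F).2 ^ e

lemma pair_twist (hq : 2 ≤ q) (e : ℤ) (c : ↥(Dset q F) → F) (i : ℕ) (j : ℤ) :
    pair (twist e c) i j = pair c i (j + e) := by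
  unfold pair
  refine Finset.sum_congr rfl fun P _ => ?_
  simp only [twist, mono]
  rw [zpow_add₀ (snd_ne hq P)]
  ring

lemma twist_ne (hq : 2 ≤ q) (e : ℤ) (c : ↥(Dset q F) → F) (P : ↥(Dset q F)) :
    twist e c P ≠ 0 ↔ c P ≠ 0 := by
  simp [twist, zpow_ne_zero e (snd_ne hq P)]

lemma wt_twist (hq : 2 ≤ q) (e : ℤ) (c : ↥(Dset q F) → F) : wt (twist e c) = wt c := by
  unfold wt
  simp only [twist_ne hq]

lemma twist_ne_zero (hq : 2 ≤ q) (e : ℤ) (c : ↥(Dset q F) → F) (hc : c ≠ 0) :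
    twist e c ≠ 0 := by
  obtain ⟨P, hP⟩ := Function.ne_iff.1 hc
  exact Function.ne_iff.2 ⟨P, (twist_ne hq e c P).2 hP⟩

end Aux

/-- Theorem 3.3, case 2′: if `0 ≤ a₁ ≤ a₀ + b₀ < b₁`, then
`d(C(K + a P∞ + b P₀)^⊥) = d* + b₁ - (a₀ + b₀)`, where `K = (q-2)(q+1) P∞`. -/
theorem minDist_case2' (q : ℕ) (hq : 2 ≤ q) (hpp : IsPrimePow q)
    (F : Type) [Field F] [Fintype F] (hF : Fintype.card F = q ^ 2)
    (a₀ b₀ a₁ b₁ a b : ℤ)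
    (ha₁ : 0 ≤ a₁ ∧ a₁ ≤ (q : ℤ)) (hb₁ : 0 ≤ b₁ ∧ b₁ ≤ (q : ℤ))
    (ha : a = a₀ * ((q : ℤ) + 1) - a₁) (hb : b = b₀ * ((q : ℤ) + 1) - b₁)
    (hdeg : 0 ≤ a + b ∧ a + b ≤ (q : ℤ) ^ 3 - 1)
    (hrange : (q : ℤ) < a + b ∨ (a + b ≤ (q : ℤ) ∧ a₁ ≠ 0 ∧ b₁ ≠ 0))
    (hcase : a₁ ≤ a₀ + b₀ ∧ a₀ + b₀ < b₁) :
    (minDist q F (((q : ℤ) - 2) * ((q : ℤ) + 1) + a) b : ℤ) = a + b + b₁ - (a₀ + b₀) := by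
  obtain ⟨s, hs⟩ : ∃ s, s = a₀ + b₀ := ⟨_, rfl⟩
  rw [← hs] at hcase ⊢
  obtain ⟨ha0, ha1⟩ := ha₁
  obtain ⟨hb0, hb1⟩ := hb₁
  obtain ⟨hc1, hc2⟩ := hcase
  have hab : a + b = s * ((q : ℤ) + 1) - a₁ - b₁ := by rw [ha, hb, hs]; ring
  have hs1 : 1 ≤ s := by
    by_contra hlt
    have : s = 0 := by omega
    rw [this] at hab
    omega
  lift s to ℕ using by omega
  lift a₁ to ℕ using ha0
  lift b₁ to ℕ using hb0
  have h1 : a₁ ≤ s := by exact_mod_cast hc1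
  have h2 : s < b₁ := by exact_mod_cast hc2
  have h3 : b₁ ≤ q := by exact_mod_cast hb1
  have hs1' : 1 ≤ s := by exact_mod_cast hs1
  have hle : a₁ ≤ s * q := h1.trans (Nat.le_mul_of_pos_right s (by omega))
  have hval : a + b + b₁ - (s : ℤ) = ((s * q - a₁ : ℕ) : ℤ) := by
    rw [hab, Nat.cast_sub hle]; push_cast; ring
  rw [hval]
  congr 1
  -- the two descriptions of the exponent ranges
  have hm : ∀ (i : ℕ) (j : ℤ), (q : ℤ) * i + (q + 1) * (j - b₀) ≤
      ((q : ℤ) - 2) * ((q : ℤ) + 1) + a ↔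
      (q : ℤ) * i + (q + 1) * j ≤ ((q : ℤ) - 2 + s) * (q + 1) - a₁ := by
    intro i j
    rw [ha, hs]
    constructor <;> intro h <;> linarith
  have hn : ∀ (i : ℕ) (j : ℤ), -b ≤ i + ((q : ℤ) + 1) * (j - b₀) ↔
      (b₁ : ℤ) ≤ i + ((q : ℤ) + 1) * j := by
    intro i j
    rw [hb]
    constructor <;> intro h <;> linarith
  apply le_antisymm
  · obtain ⟨A, f, hA, hf, hfA⟩ := construct hq hpp hF s a₁ h1 (by omega)
    obtain ⟨c, hc, hw, hz⟩ := upper hq s a₁ b₁ h1 h2 h3 hs1' A hA f hf hfA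
    refine le_trans (Nat.sInf_le ⟨twist b₀ c, ?_, twist_ne_zero hq _ c hc, rfl⟩)
      ((wt_twist hq _ c).le.trans hw)
    rw [mem_dual]
    intro i _ j e1 e2
    rw [pair_twist hq]
    apply hz
    · rw [← hm, add_sub_cancel_right]; exact e1
    · rw [← hn, add_sub_cancel_right]; exact e2
  · have hne : {w | ∃ c ∈ dualCode q F (((q : ℤ) - 2) * ((q : ℤ) + 1) + a) b,
        c ≠ 0 ∧ wt c = w}.Nonempty := by
      obtain ⟨A, f, hA, hf, hfA⟩ := construct hq hpp hF s a₁ h1 (by omega)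
      obtain ⟨c, hc, hw, hz⟩ := upper hq s a₁ b₁ h1 h2 h3 hs1' A hA f hf hfA
      refine ⟨_, twist b₀ c, ?_, twist_ne_zero hq _ c hc, rfl⟩
      rw [mem_dual]
      intro i _ j e1 e2
      rw [pair_twist hq]
      apply hz
      · rw [← hm, add_sub_cancel_right]; exact e1
      · rw [← hn, add_sub_cancel_right]; exact e2
    refine le_csInf hne ?_
    rintro w ⟨c, hcd, hc, rfl⟩
    rw [mem_dual] at hcd
    rw [← wt_twist hq (-b₀) c]
    refine lower hq hF _ (twist_ne_zero hq _ c hc) s a₁ b₁ h1 h2 h3 hs1' ?_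
    intro i hi j e1 e2
    rw [pair_twist hq, ← sub_eq_add_neg]
    exact hcd i hi _ ((hm i j).2 e1) ((hn i j).2 e2)

end HermitianTwoPoint
end
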